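/- Let n ≥ 3 and let 0 ≤ a < (n-2)/2, a ≤ b < a+1, p = 2n/(n-2+2(b-a)), ν > 0, α, β > 1 with α + β = p. Let (u, v) be a positive finite-energy solution of the Hénon–Sobolev system (S). Then u and v are bounded: there exists a constant C > 0 such that u(x) ≤ C and v(x) ≤ C for all x ∈ ℝⁿ \ {0}. -/

import Mathlib

open MeasureTheory Real Filter Topology

noncomputable section

/-- Coordinate Laplacian on Euclidean space. -/
def lapl {n : ℕ} (w : EuclideanSpace ℝ (Fin n) → ℝ) (x : EuclideanSpace ℝ (Fin n)) : ℝ :=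
  ∑ i : Fin n, fderiv ℝ (fun y => fderiv ℝ w y (EuclideanSpace.single i 1)) x
    (EuclideanSpace.single i 1)

/-- The weighted divergence `div(|x|^(-2a) ∇w)(x) = |x|^(-2a) (Δw(x) - 2a⟨x,∇w(x)⟩/|x|²)`. -/
def wdiv {n : ℕ} (a : ℝ) (w : EuclideanSpace ℝ (Fin n) → ℝ) (x : EuclideanSpace ℝ (Fin n)) : ℝ :=
  ‖x‖ ^ (-(2*a)) * (lapl w x - 2*a * (@inner ℝ _ _ x (gradient w x)) / ‖x‖^2)

/-- Finiteness of the weighted Dirichlet energy `∫ |x|^(-2a) |∇w|² < ∞`. -/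
def finiteEnergy {n : ℕ} (a : ℝ) (w : EuclideanSpace ℝ (Fin n) → ℝ) : Prop :=
  Integrable (fun x : EuclideanSpace ℝ (Fin n) => ‖x‖ ^ (-(2*a)) * ‖gradient w x‖^2)

local notation "𝔼" n => EuclideanSpace ℝ (Fin n)

theorem contDiff_fderiv_apply {n : ℕ} {g : (𝔼 n) → ℝ} (hg : ContDiff ℝ 2 g) (v : 𝔼 n) :
    ContDiff ℝ 1 (fun y => fderiv ℝ g y v) :=
  (hg.fderiv_right (m := 1) (by norm_num)).clm_apply contDiff_const

theorem continuous_lapl {n : ℕ} {g : (𝔼 n) → ℝ} (hg : ContDiff ℝ 2 g) :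
    Continuous (lapl g) := by
  unfold lapl
  refine continuous_finsetSum _ fun i _ => ?_
  exact ((contDiff_fderiv_apply hg _).continuous_fderiv (by norm_num)).clm_apply continuous_const

theorem fderiv_comp_affine {n : ℕ} {g : (𝔼 n) → ℝ} (x₀ : 𝔼 n) (r : ℝ) (y : 𝔼 n) :
    fderiv ℝ (fun y => g (x₀ + r • y)) y = r • fderiv ℝ g (x₀ + r • y) := by
  have h := fderiv_comp_smul (𝕜 := ℝ) (f := fun z => g (x₀ + z)) (x := y) r
  rw [fderiv_comp_add_left] at h
  exact h

theorem lapl_comp_affine {n : ℕ} {g : (𝔼 n) → ℝ} (hg : ContDiff ℝ 2 g) (x₀ : 𝔼 n) (r : ℝ)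
    (y : 𝔼 n) :
    lapl (fun y => g (x₀ + r • y)) y = r ^ 2 * lapl g (x₀ + r • y) := by
  unfold lapl
  rw [Finset.mul_sum]
  refine Finset.sum_congr rfl fun i _ => ?_
  simp_rw [fderiv_comp_affine]
  have h2 : DifferentiableAt ℝ
      (fun y => fderiv ℝ g (x₀ + r • y) (EuclideanSpace.single i 1)) y := by
    have := ((contDiff_fderiv_apply hg (EuclideanSpace.single i 1)).differentiable (by norm_num))
    exact DifferentiableAt.comp (f := fun y => x₀ + r • y) y (this (x₀ + r • y)) (by fun_prop)
  have h3 := fderiv_const_smul h2 r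
  have h4 := fderiv_comp_affine (g := fun z => fderiv ℝ g z (EuclideanSpace.single i 1)) x₀ r y
  rw [h4] at h3
  have h5 := congrArg (fun L : (𝔼 n) →L[ℝ] ℝ => L (EuclideanSpace.single i 1)) h3
  simp only [smul_apply, smul_eq_mul] at h5 ⊢
  rw [pow_two, mul_assoc, ← h5]
  rfl

/-- The quadratic bump `(1 - |y|²)₊² / 4`. -/
def qbump {n : ℕ} (y : 𝔼 n) : ℝ := (max 0 (1 - ‖y‖ ^ 2)) ^ 2 / 4

/-- The tent `(1 - |y|²)₊`. -/
def qtent {n : ℕ} (y : 𝔼 n) : ℝ := max 0 (1 - ‖y‖ ^ 2)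

theorem hasDerivAt_posPart_sq (s : ℝ) :
    HasDerivAt (fun s : ℝ => (max 0 s) ^ 2) (2 * max 0 s) s := by
  rcases lt_trichotomy s 0 with hs | hs | hs
  · rw [max_eq_left hs.le]
    refine (hasDerivAt_const s (0:ℝ)).congr_of_eventuallyEq ?_ |>.congr_deriv (by simp)
    filter_upwards [eventually_lt_nhds hs] with t ht
    simp [max_eq_left ht.le]
  · subst hs
    simp only [max_self, mul_zero]
    rw [hasDerivAt_iff_isLittleO_nhds_zero]
    simp only [zero_add, max_self, smul_zero, sub_zero, ne_eq, OfNat.ofNat_ne_zero,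
      not_false_eq_true, zero_pow]
    rw [Asymptotics.isLittleO_iff]
    intro c hc
    have : ∀ᶠ t : ℝ in 𝓝 0, |t| < c := by
      have := Metric.ball_mem_nhds (0:ℝ) hc
      filter_upwards [this] with t ht
      simpa using ht
    filter_upwards [this] with t ht
    rw [Real.norm_eq_abs, Real.norm_eq_abs, abs_pow, pow_two]
    have h1 : |max 0 t| ≤ |t| := by
      rcases le_total 0 t with h | h <;> simp [h]
    gcongr
    exact h1.trans ht.le
  · rw [max_eq_right hs.le]
    refine ((hasDerivAt_pow 2 s).congr_of_eventuallyEq ?_).congr_deriv (by simp)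
    filter_upwards [eventually_gt_nhds hs] with t ht
    simp [max_eq_right ht.le]

theorem hasFDerivAt_qbump {n : ℕ} (y : 𝔼 n) :
    HasFDerivAt (qbump (n := n)) (-(qtent y) • innerSL ℝ y) y := by
  have h1 : HasFDerivAt (fun y : 𝔼 n => 1 - ‖y‖ ^ 2) (-(2 • innerSL ℝ y)) y := by
    simpa using (hasStrictFDerivAt_norm_sq y).hasFDerivAt.const_sub 1
  have h2 := ((hasDerivAt_posPart_sq (1 - ‖y‖ ^ 2)).div_const 4).comp_hasFDerivAt y h1
  refine h2.congr_fderiv ?_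
  ext v
  simp [qtent]
  ring

theorem fderiv_qbump {n : ℕ} (y v : 𝔼 n) :
    fderiv ℝ (qbump (n := n)) y v = -(qtent y) * inner ℝ y v := by
  rw [(hasFDerivAt_qbump y).fderiv]; simp

theorem continuous_qtent {n : ℕ} : Continuous (qtent (n := n)) := by
  unfold qtent; fun_prop

theorem contDiff_qbump {n : ℕ} : ContDiff ℝ 1 (qbump (n := n)) := by
  rw [contDiff_one_iff_fderiv]
  refine ⟨fun y => (hasFDerivAt_qbump y).differentiableAt, ?_⟩
  have : fderiv ℝ (qbump (n := n)) = fun y => -(qtent y) • innerSL ℝ y :=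
    funext fun y => (hasFDerivAt_qbump y).fderiv
  rw [this]
  exact (continuous_qtent.neg).smul (innerSL ℝ).continuous

theorem qtent_eq_zero {n : ℕ} {y : 𝔼 n} (hy : 1 ≤ ‖y‖) : qtent y = 0 := by
  unfold qtent; rw [max_eq_left]; nlinarith

theorem qbump_eq {n : ℕ} (y : 𝔼 n) : qbump y = qtent y ^ 2 / 4 := rfl

theorem qtent_nonneg {n : ℕ} (y : 𝔼 n) : 0 ≤ qtent y := le_max_left _ _

theorem qtent_le_one {n : ℕ} (y : 𝔼 n) : qtent y ≤ 1 :=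
  max_le (by norm_num) (by nlinarith [sq_nonneg ‖y‖])

theorem qbump_nonneg {n : ℕ} (y : 𝔼 n) : 0 ≤ qbump y := by unfold qbump; positivity

theorem qbump_le_one {n : ℕ} (y : 𝔼 n) : qbump y ≤ 1 := by
  rw [qbump_eq]; nlinarith [qtent_nonneg y, qtent_le_one y]

theorem hasCompactSupport_of_eq_zero {n : ℕ} {f : (𝔼 n) → ℝ} (R : ℝ)
    (hf : ∀ y, R ≤ ‖y‖ → f y = 0) : HasCompactSupport f := by
  refine HasCompactSupport.intro (isCompact_closedBall (0 : 𝔼 n) R) fun y hy => hf y ?_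
  simp at hy
  exact hy.le

theorem integral_mul_fderiv {n : ℕ} {f g : (𝔼 n) → ℝ} (hf : ContDiff ℝ 1 f)
    (hfc : HasCompactSupport f) (hg : ContDiff ℝ 1 g) (v : 𝔼 n) :
    ∫ y, f y * fderiv ℝ g y v = -∫ y, fderiv ℝ f y v * g y := by
  have cf := hf.continuous
  have cg := hg.continuous
  have cf' : Continuous fun y => fderiv ℝ f y v :=
    (hf.continuous_fderiv (by norm_num)).clm_apply continuous_const
  have cg' : Continuous fun y => fderiv ℝ g y v :=
    (hg.continuous_fderiv (by norm_num)).clm_apply continuous_const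
  have hc' : HasCompactSupport fun y => fderiv ℝ f y v := hfc.fderiv_apply (𝕜 := ℝ) v
  refine integral_mul_fderiv_eq_neg_fderiv_mul_of_integrable ?_ ?_ ?_
    (fun x _ => hf.differentiable (by norm_num) x) (fun x _ => hg.differentiable (by norm_num) x)
  · exact (cf'.mul cg).integrable_of_hasCompactSupport hc'.mul_right
  · exact (cf.mul cg').integrable_of_hasCompactSupport hfc.mul_right
  · exact (cf.mul cg).integrable_of_hasCompactSupport hfc.mul_right

theorem integral_mul_lapl {n : ℕ} {f g : (𝔼 n) → ℝ} (hf : ContDiff ℝ 1 f)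
    (hfc : HasCompactSupport f) (hg : ContDiff ℝ 2 g) :
    ∫ y, f y * lapl g y = -∫ y, ∑ i : Fin n,
      fderiv ℝ f y (EuclideanSpace.single i 1) * fderiv ℝ g y (EuclideanSpace.single i 1) := by
  have cf' (v) : Continuous fun y => fderiv ℝ f y v :=
    (hf.continuous_fderiv (by norm_num)).clm_apply continuous_const
  unfold lapl
  simp_rw [Finset.mul_sum]
  rw [integral_finsetSum, integral_finsetSum, ← Finset.sum_neg_distrib]
  · refine Finset.sum_congr rfl fun i _ => ?_
    exact integral_mul_fderiv hf hfc (contDiff_fderiv_apply hg _) _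
  · intro i _
    exact ((cf' _).mul (contDiff_fderiv_apply hg _).continuous).integrable_of_hasCompactSupport
      (hfc.fderiv_apply (𝕜 := ℝ) _).mul_right
  · intro i _
    exact (hf.continuous.mul (((contDiff_fderiv_apply hg _).continuous_fderiv
      (by norm_num)).clm_apply continuous_const)).integrable_of_hasCompactSupport hfc.mul_right

theorem fderiv_eq_sum {n : ℕ} (L : (𝔼 n) →L[ℝ] ℝ) (x : 𝔼 n) :
    L x = ∑ i, x i * L (EuclideanSpace.single i 1) := by
  have h : x = ∑ i, x i • EuclideanSpace.single i (1:ℝ) := by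
    have := (EuclideanSpace.basisFun (Fin n) ℝ).sum_repr x
    simpa using this.symm
  conv_lhs => rw [h]
  simp

theorem abs_integral_le_of_closedBall {n : ℕ} {f : (𝔼 n) → ℝ} (R C : ℝ)
    (h0 : ∀ y, R < ‖y‖ → f y = 0) (hC : ∀ y, ‖y‖ ≤ R → |f y| ≤ C) :
    |∫ y, f y| ≤ C * volume.real (Metric.closedBall (0 : 𝔼 n) R) := by
  have hs : ∫ y in Metric.closedBall (0 : 𝔼 n) R, f y = ∫ y, f y := by
    refine setIntegral_eq_integral_of_forall_compl_eq_zero fun y hy => h0 y ?_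
    simpa using hy
  rw [← hs, ← Real.norm_eq_abs]
  refine norm_setIntegral_le_of_norm_le_const measure_closedBall_lt_top fun y hy => hC y ?_
  simpa using hy

theorem norm_affine_ge {n : ℕ} {x₀ y : 𝔼 n} {r : ℝ} (hr : 0 ≤ r)
    (h : r * ‖y‖ ≤ ‖x₀‖ / 2) : ‖x₀‖ / 2 ≤ ‖x₀ + r • y‖ := by
  have h1 := norm_sub_norm_le x₀ (-(r • y))
  rw [norm_neg, norm_smul, Real.norm_of_nonneg hr, sub_neg_eq_add] at h1
  linarith

theorem abs_coord_le {n : ℕ} (x : 𝔼 n) (i : Fin n) : |x i| ≤ ‖x‖ := by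
  simpa using PiLp.norm_apply_le x i

theorem inverted_coord_fderiv {n : ℕ} {x : 𝔼 n} (hx : x ≠ 0) (i : Fin n) :
    ContDiffAt ℝ 1 (fun x : 𝔼 n => x i / ‖x‖ ^ 2) x ∧
    |fderiv ℝ (fun x : 𝔼 n => x i / ‖x‖ ^ 2) x (EuclideanSpace.single i 1)| ≤ 1 / ‖x‖ ^ 2 := by
  have hn : 0 < ‖x‖ := norm_pos_iff.2 hx
  have h1 : HasFDerivAt (fun x : 𝔼 n => ‖x‖ ^ 2) (2 • innerSL ℝ x) x :=
    (hasStrictFDerivAt_norm_sq x).hasFDerivAt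
  have h2 : HasFDerivAt (fun x : 𝔼 n => x i) (EuclideanSpace.proj i : (𝔼 n) →L[ℝ] ℝ) x :=
    (EuclideanSpace.proj i : (𝔼 n) →L[ℝ] ℝ).hasFDerivAt
  have c2 : ContDiff ℝ 1 (fun x : 𝔼 n => x i) :=
    (EuclideanSpace.proj i : (𝔼 n) →L[ℝ] ℝ).contDiff
  refine ⟨c2.contDiffAt.div (contDiff_norm_sq ℝ).contDiffAt (by positivity), ?_⟩
  have h3 := h2.mul ((hasDerivAt_inv (x := ‖x‖ ^ 2) (by positivity)).comp_hasFDerivAt x h1)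
  have h4 : fderiv ℝ (fun x : 𝔼 n => x i / ‖x‖ ^ 2) x (EuclideanSpace.single i 1)
      = (‖x‖ ^ 2 - 2 * (x i) ^ 2) / (‖x‖ ^ 2) ^ 2 := by
    rw [HasFDerivAt.fderiv (f := fun x : 𝔼 n => x i / ‖x‖ ^ 2) h3]
    simp [EuclideanSpace.inner_single_right]
    field_simp
    ring
  rw [h4, abs_div, abs_of_pos (a := (‖x‖ ^ 2) ^ 2) (by positivity),
    div_le_div_iff₀ (by positivity) (by positivity)]
  have h5 : (x i) ^ 2 ≤ ‖x‖ ^ 2 := by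
    rw [← sq_abs]; gcongr; exact abs_coord_le x i
  have : |‖x‖ ^ 2 - 2 * x i ^ 2| ≤ ‖x‖ ^ 2 := by
    rw [abs_le]; constructor <;> nlinarith [sq_nonneg (x i)]
  nlinarith [sq_nonneg ‖x‖]

theorem abs_fderiv_qbump_le {n : ℕ} (y v : 𝔼 n) (hv : ‖v‖ ≤ 1) :
    |fderiv ℝ (qbump (n := n)) y v| ≤ 1 := by
  rw [fderiv_qbump, abs_mul, abs_neg, abs_of_nonneg (qtent_nonneg y)]
  rcases le_total 1 ‖y‖ with h | h
  · simp [qtent_eq_zero h]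
  · have h1 := abs_real_inner_le_norm y v
    have h2 : |inner ℝ y v| ≤ 1 := h1.trans (mul_le_one₀ h (norm_nonneg _) hv)
    exact mul_le_one₀ (qtent_le_one y) (abs_nonneg _) h2

theorem qbump_eq_zero {n : ℕ} {y : 𝔼 n} (hy : 1 ≤ ‖y‖) : qbump y = 0 := by
  rw [qbump_eq, qtent_eq_zero hy]; simp

/-- The drift part `x / |x|²` tested against the bump, after integration by parts. -/
theorem abs_integral_qbump_drift_le {n : ℕ} {x₀ : 𝔼 n} (hx₀ : x₀ ≠ 0) {r S : ℝ} (hr : 0 < r)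
    (hr2 : r ≤ ‖x₀‖ / 2) {h : (𝔼 n) → ℝ} (hh : ContDiff ℝ 2 h)
    (h0 : ∀ y, ‖y‖ ≤ 1 → 0 ≤ h y) (hS : ∀ y, ‖y‖ ≤ 1 → h y ≤ S) :
    |∫ y, qbump y * (fderiv ℝ h y (x₀ + r • y) / ‖x₀ + r • y‖ ^ 2)|
      ≤ n * (4 / ‖x₀‖ * S * volume.real (Metric.closedBall (0 : 𝔼 n) 1)) := by
  have hx : 0 < ‖x₀‖ := norm_pos_iff.2 hx₀
  set X : Fin n → (𝔼 n) → ℝ := fun i y => (x₀ + r • y) i / ‖x₀ + r • y‖ ^ 2 with hX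
  have hXc (i : Fin n) (y : 𝔼 n) (hy : x₀ + r • y ≠ 0) : ContDiffAt ℝ 1 (X i) y :=
    ContDiffAt.comp (f := fun y => x₀ + r • y) y (inverted_coord_fderiv hy i).1
      (by fun_prop)
  set f : Fin n → (𝔼 n) → ℝ := fun i y => qbump y * X i y with hf
  have hge (y : 𝔼 n) (hy : ‖y‖ ≤ 1) : ‖x₀‖ / 2 ≤ ‖x₀ + r • y‖ :=
    norm_affine_ge hr.le (by nlinarith)
  have hev (y : 𝔼 n) (hy : 1 < ‖y‖) (i : Fin n) : f i =ᶠ[𝓝 y] 0 := by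
    filter_upwards [(isOpen_lt continuous_const continuous_norm).mem_nhds hy] with z hz
    simp [hf, qbump_eq_zero (le_of_lt hz)]
  have hfc (i : Fin n) : ContDiff ℝ 1 (f i) := by
    rw [contDiff_iff_contDiffAt]
    intro y
    rcases le_or_gt ‖y‖ 1 with hy | hy
    · refine contDiff_qbump.contDiffAt.mul (hXc i y ?_)
      rw [← norm_pos_iff]; linarith [hge y hy]
    · exact contDiffAt_const.congr_of_eventuallyEq (hev y hy i)
  have hfs (i : Fin n) : HasCompactSupport (f i) :=
    hasCompactSupport_of_eq_zero 1 fun y hy => by simp [hf, qbump_eq_zero hy]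
  have hS0 : 0 ≤ S := (h0 0 (by simp)).trans (hS 0 (by simp))
  have key (y : 𝔼 n) : qbump y * (fderiv ℝ h y (x₀ + r • y) / ‖x₀ + r • y‖ ^ 2)
      = ∑ i, f i y * fderiv ℝ h y (EuclideanSpace.single i 1) := by
    rw [fderiv_eq_sum (fderiv ℝ h y) (x₀ + r • y), Finset.sum_div, Finset.mul_sum]
    refine Finset.sum_congr rfl fun i _ => ?_
    simp only [hf, hX]; ring
  have hh1 : ContDiff ℝ 1 h := hh.of_le (by norm_num)
  simp_rw [key]
  rw [integral_finsetSum]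
  swap
  · intro i _
    exact ((hfc i).continuous.mul (contDiff_fderiv_apply hh
      _).continuous).integrable_of_hasCompactSupport (hfs i).mul_right
  refine (Finset.abs_sum_le_sum_abs _ _).trans ?_
  have hcard : (n:ℝ) * (4 / ‖x₀‖ * S * volume.real (Metric.closedBall (0 : 𝔼 n) 1))
      = ∑ i : Fin n, (4 / ‖x₀‖ * S * volume.real (Metric.closedBall (0 : 𝔼 n) 1)) := by simp
  rw [hcard]
  refine Finset.sum_le_sum fun i _ => ?_
  rw [integral_mul_fderiv (hfc i) (hfs i) hh1, abs_neg]
  refine abs_integral_le_of_closedBall 1 _ (fun y hy => ?_) (fun y hy => ?_)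
  · rw [(hev y hy i).fderiv_eq]; simp
  · rw [abs_mul, abs_of_nonneg (h0 y hy)]
    refine mul_le_mul ?_ (hS y hy) (h0 y hy) (by positivity)
    have hyx := hge y hy
    have hpos : 0 < ‖x₀ + r • y‖ := by linarith
    have hne : x₀ + r • y ≠ 0 := norm_pos_iff.1 hpos
    have hd : fderiv ℝ (f i) y (EuclideanSpace.single i 1) =
        qbump y * (r * fderiv ℝ (fun x : 𝔼 n => x i / ‖x‖ ^ 2) (x₀ + r • y)
          (EuclideanSpace.single i 1)) +
        X i y * fderiv ℝ (qbump (n := n)) y (EuclideanSpace.single i 1) := by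
      have e1 := fderiv_fun_mul ((hasFDerivAt_qbump y).differentiableAt)
        ((hXc i y hne).differentiableAt (by norm_num))
      have e2 := fderiv_comp_affine (g := fun x : 𝔼 n => x i / ‖x‖ ^ 2) x₀ r y
      have e3 : fderiv ℝ (X i) y = r • fderiv ℝ (fun x : 𝔼 n => x i / ‖x‖ ^ 2) (x₀ + r • y) := e2
      rw [e3] at e1
      have e4 := congrArg (fun L : (𝔼 n) →L[ℝ] ℝ => L (EuclideanSpace.single i 1)) e1
      simpa using e4
    rw [hd]
    have a1 : |qbump y * (r * fderiv ℝ (fun x : 𝔼 n => x i / ‖x‖ ^ 2) (x₀ + r • y)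
          (EuclideanSpace.single i 1))| ≤ 2 / ‖x₀‖ := by
      rw [abs_mul, abs_of_nonneg (qbump_nonneg y), abs_mul, abs_of_pos hr]
      have b1 := (inverted_coord_fderiv hne i).2
      have b2 : 1 / ‖x₀ + r • y‖ ^ 2 ≤ 1 / (‖x₀‖ / 2) ^ 2 := by gcongr
      have b3 : r * |fderiv ℝ (fun x : 𝔼 n => x i / ‖x‖ ^ 2) (x₀ + r • y)
          (EuclideanSpace.single i 1)| ≤ (‖x₀‖ / 2) * (1 / (‖x₀‖ / 2) ^ 2) :=
        mul_le_mul hr2 (b1.trans b2) (abs_nonneg _) (by positivity)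
      have b4 : (‖x₀‖ / 2) * (1 / (‖x₀‖ / 2) ^ 2) = 2 / ‖x₀‖ := by field_simp
      rw [b4] at b3
      calc _ ≤ 1 * (2 / ‖x₀‖) := mul_le_mul (qbump_le_one y) b3 (by positivity) (by norm_num)
        _ = _ := one_mul _
    have a2 : |X i y * fderiv ℝ (qbump (n := n)) y (EuclideanSpace.single i 1)| ≤ 2 / ‖x₀‖ := by
      rw [abs_mul]
      have b1 : |X i y| ≤ 2 / ‖x₀‖ := by
        simp only [hX]
        rw [abs_div, abs_of_pos (a := ‖x₀ + r • y‖ ^ 2) (by positivity)]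
        calc _ ≤ ‖x₀ + r • y‖ / ‖x₀ + r • y‖ ^ 2 := by gcongr; exact abs_coord_le _ i
          _ = 1 / ‖x₀ + r • y‖ := by field_simp
          _ ≤ 1 / (‖x₀‖ / 2) := by gcongr
          _ = _ := by field_simp
      calc _ ≤ (2 / ‖x₀‖) * 1 := mul_le_mul b1 (abs_fderiv_qbump_le y _ (by simp)) (abs_nonneg _)
            (by positivity)
        _ = _ := mul_one _
    refine (abs_add_le _ _).trans ?_
    have : 4 / ‖x₀‖ = 2 / ‖x₀‖ + 2 / ‖x₀‖ := by ring
    linarith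

theorem integrable_qtent_mul {n : ℕ} {f : (𝔼 n) → ℝ} (hf : Continuous f) :
    Integrable (fun y => f y * qtent y) :=
  (hf.mul continuous_qtent).integrable_of_hasCompactSupport
    (hasCompactSupport_of_eq_zero 1 fun y hy => by simp [qtent_eq_zero hy])

theorem integrable_qbump_mul {n : ℕ} {f : (𝔼 n) → ℝ} (hf : Continuous f) :
    Integrable (fun y => qbump y * f y) :=
  (contDiff_qbump.continuous.mul hf).integrable_of_hasCompactSupport
    (hasCompactSupport_of_eq_zero 1 fun y hy => by simp [qbump_eq_zero hy])

theorem integral_qbump_mul_lapl {n : ℕ} {h : (𝔼 n) → ℝ} (hh : ContDiff ℝ 2 h) :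
    ∫ y, qbump y * lapl h y = ∫ y, fderiv ℝ h y y * qtent y := by
  rw [integral_mul_lapl contDiff_qbump
    (hasCompactSupport_of_eq_zero 1 fun y hy => qbump_eq_zero hy) hh, ← integral_neg]
  refine integral_congr_ae (Eventually.of_forall fun y => ?_)
  simp only
  rw [fderiv_eq_sum (fderiv ℝ h y) y, ← Finset.sum_neg_distrib, Finset.sum_mul]
  refine Finset.sum_congr rfl fun i _ => ?_
  rw [fderiv_qbump]
  simp [EuclideanSpace.inner_single_right]
  ring

theorem hasDerivAt_dilated_average {n : ℕ} {g : (𝔼 n) → ℝ} (hg : ContDiff ℝ 2 g) (x₀ : 𝔼 n)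
    (r : ℝ) :
    HasDerivAt (fun r : ℝ => ∫ y, g (x₀ + r • y) * qtent y)
      (∫ y, fderiv ℝ g (x₀ + r • y) y * qtent y) r := by
  have hc : Continuous (fun q : ℝ × 𝔼 n => fderiv ℝ g (x₀ + q.1 • q.2) q.2) :=
    ((hg.continuous_fderiv (by norm_num)).comp (by fun_prop)).clm_apply continuous_snd
  obtain ⟨C, hC⟩ := ((isCompact_closedBall r 1).prod
    (isCompact_closedBall (0 : 𝔼 n) 1)).exists_bound_of_continuousOn hc.continuousOn
  have cF (t : ℝ) : Continuous fun y : 𝔼 n => g (x₀ + t • y) := hg.continuous.comp (by fun_prop)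
  have cF' (t : ℝ) : Continuous fun y : 𝔼 n => fderiv ℝ g (x₀ + t • y) y :=
    hc.comp (f := fun y : 𝔼 n => (t, y)) (by fun_prop)
  refine (hasDerivAt_integral_of_dominated_loc_of_deriv_le (μ := volume)
    (F := fun (r : ℝ) (y : 𝔼 n) => g (x₀ + r • y) * qtent y)
    (F' := fun (r : ℝ) (y : 𝔼 n) => fderiv ℝ g (x₀ + r • y) y * qtent y)
    (bound := fun y => C * qtent y) (s := Metric.closedBall r 1)
    (Metric.closedBall_mem_nhds r one_pos) ?_ ?_ ?_ ?_ ?_ ?_).2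
  · exact Eventually.of_forall fun t => ((cF t).mul continuous_qtent).aestronglyMeasurable
  · exact integrable_qtent_mul (cF r)
  · exact ((cF' r).mul continuous_qtent).aestronglyMeasurable
  · refine Eventually.of_forall fun y t ht => ?_
    rw [norm_mul, Real.norm_of_nonneg (qtent_nonneg y)]
    rcases le_or_gt ‖y‖ 1 with hy | hy
    · exact mul_le_mul_of_nonneg_right (hC (t, y) ⟨ht, by simpa using hy⟩) (qtent_nonneg y)
    · simp [qtent_eq_zero hy.le]
  · exact integrable_qtent_mul continuous_const
  · refine Eventually.of_forall fun y t _ => ?_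
    have h1 : HasDerivAt (fun t : ℝ => x₀ + t • y) y t := by
      simpa using ((hasDerivAt_id t).smul_const y).const_add x₀
    have h2 := (hg.differentiable (by norm_num) (x₀ + t • y)).hasFDerivAt.comp_hasDerivAt t h1
    exact h2.mul_const _

/-- Mean value inequality at a point for functions satisfying
`Δg ≥ 2a⟨x,∇g⟩/|x|² - N₀` near that point. -/
theorem le_average_add {n : ℕ} {a : ℝ} (ha : 0 ≤ a) {x₀ : 𝔼 n} (hx₀ : x₀ ≠ 0) {ρ S N₀ : ℝ}
    (hρ : 0 < ρ) (hρ2 : ρ ≤ ‖x₀‖ / 2) (hN : 0 ≤ N₀) {g : (𝔼 n) → ℝ} (hg : ContDiff ℝ 2 g)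
    (h0 : ∀ x, ‖x - x₀‖ ≤ ρ → 0 ≤ g x) (hS : ∀ x, ‖x - x₀‖ ≤ ρ → g x ≤ S)
    (hL : ∀ x, ‖x - x₀‖ ≤ ρ → 2 * a * (fderiv ℝ g x x / ‖x‖ ^ 2) - N₀ ≤ lapl g x) :
    g x₀ * ∫ y : 𝔼 n, qtent y ≤ (∫ y, g (x₀ + ρ • y) * qtent y) +
      volume.real (Metric.closedBall (0 : 𝔼 n) 1) *
        (8 * a * n * (ρ / ‖x₀‖) * S + ρ ^ 2 * N₀) := by
  set V := volume.real (Metric.closedBall (0 : 𝔼 n) 1) with hV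
  set B : ℝ → ℝ := fun r => ∫ y, g (x₀ + r • y) * qtent y with hB
  have hx : 0 < ‖x₀‖ := norm_pos_iff.2 hx₀
  have hV0 : 0 ≤ V := measureReal_nonneg
  have hBd := hasDerivAt_dilated_average hg x₀
  have hder (r : ℝ) (hr : r ∈ Set.Ioo 0 ρ) : -(V * (8 * a * n * S / ‖x₀‖ + ρ * N₀)) ≤ deriv B r := by
    obtain ⟨hr0, hrρ⟩ := hr
    rw [(hBd r).deriv]
    set h : (𝔼 n) → ℝ := fun y => g (x₀ + r • y) with hh
    have hhc : ContDiff ℝ 2 h := hg.comp (by fun_prop)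
    have hin (y : 𝔼 n) (hy : ‖y‖ ≤ 1) : ‖x₀ + r • y - x₀‖ ≤ ρ := by
      rw [add_sub_cancel_left, norm_smul, Real.norm_of_nonneg hr0.le]; nlinarith
    have e1 : r * (∫ y, fderiv ℝ g (x₀ + r • y) y * qtent y) = ∫ y, qbump y * lapl h y := by
      rw [integral_qbump_mul_lapl hhc, ← integral_const_mul]
      refine integral_congr_ae (Eventually.of_forall fun y => ?_)
      simp only [hh]
      rw [fderiv_comp_affine]
      simp [mul_assoc]
    have hdr := abs_integral_qbump_drift_le hx₀ hr0 (by linarith) hhc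
      (fun y hy => h0 _ (hin y hy)) (fun y hy => hS _ (hin y hy))
    have hge (y : 𝔼 n) (hy : ‖y‖ ≤ 1) : ‖x₀‖ / 2 ≤ ‖x₀ + r • y‖ :=
      norm_affine_ge hr0.le (by nlinarith)
    -- integrability of the drift term
    have hdi : Integrable fun y => qbump y * (fderiv ℝ h y (x₀ + r • y) / ‖x₀ + r • y‖ ^ 2) := by
      have hcts : ContinuousOn
          (fun y => qbump y * (fderiv ℝ h y (x₀ + r • y) / ‖x₀ + r • y‖ ^ 2))
          (Metric.closedBall 0 1) := by
        refine contDiff_qbump.continuous.continuousOn.mul (ContinuousOn.div ?_ (by fun_prop) ?_)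
        · exact ((hhc.continuous_fderiv (by norm_num)).clm_apply (by fun_prop)).continuousOn
        · intro y hy
          have := hge y (by simpa using hy)
          have : 0 < ‖x₀ + r • y‖ := by linarith
          positivity
      have := hcts.integrableOn_compact (μ := volume) (isCompact_closedBall (0 : 𝔼 n) 1)
      refine this.integrable_of_forall_notMem_eq_zero fun y hy => ?_
      have hy : 1 < ‖y‖ := by simpa using hy
      simp [qbump_eq_zero hy.le]
    have hbi : Integrable (fun y : 𝔼 n => qbump y) := by
      simpa using integrable_qbump_mul (n := n) (f := fun _ => (1:ℝ)) continuous_const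
    have e2 : (∫ y, (2 * a * r * (qbump y * (fderiv ℝ h y (x₀ + r • y) / ‖x₀ + r • y‖ ^ 2))
        - r ^ 2 * N₀ * qbump y)) ≤ ∫ y, qbump y * lapl h y := by
      refine integral_mono ((hdi.const_mul _).sub (hbi.const_mul _))
        (integrable_qbump_mul (continuous_lapl hhc)) fun y => ?_
      simp only
      rcases le_or_gt ‖y‖ 1 with hy | hy
      · have l1 := hL _ (hin y hy)
        rw [lapl_comp_affine hg, fderiv_comp_affine]
        simp only [smul_apply, smul_eq_mul]
        have l2 := mul_le_mul_of_nonneg_left l1 (mul_nonneg (qbump_nonneg y) (sq_nonneg r))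
        calc _ = qbump y * r ^ 2 * (2 * a * (fderiv ℝ g (x₀ + r • y) (x₀ + r • y) /
              ‖x₀ + r • y‖ ^ 2) - N₀) := by ring
          _ ≤ _ := l2
          _ = _ := by ring
      · simp [qbump_eq_zero hy.le]
    rw [integral_sub (hdi.const_mul _) (hbi.const_mul _), integral_const_mul, integral_const_mul,
      ← e1] at e2
    have e3 : |∫ y : 𝔼 n, qbump y| ≤ 1 * V := by
      refine abs_integral_le_of_closedBall 1 1 (fun y hy => qbump_eq_zero hy.le) fun y _ => ?_
      rw [abs_of_nonneg (qbump_nonneg y)]; exact qbump_le_one y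
    set I := ∫ y, qbump y * (fderiv ℝ h y (x₀ + r • y) / ‖x₀ + r • y‖ ^ 2)
    set J := ∫ y, fderiv ℝ g (x₀ + r • y) y * qtent y
    have e4 := (abs_le.1 hdr).1
    have e5 := (abs_le.1 e3).2
    have e6 : r * (-(V * (8 * a * n * S / ‖x₀‖ + ρ * N₀))) ≤ r * J := by
      have f1 : 2 * a * r * (-(n * (4 / ‖x₀‖ * S * V))) ≤ 2 * a * r * I :=
        mul_le_mul_of_nonneg_left e4 (by positivity)
      have f2 : r ^ 2 * N₀ * ∫ y : 𝔼 n, qbump y ≤ r * ρ * N₀ * V := by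
        calc _ ≤ r ^ 2 * N₀ * (1 * V) := mul_le_mul_of_nonneg_left e5 (by positivity)
          _ = r * r * (N₀ * V) := by ring
          _ ≤ r * ρ * (N₀ * V) := by gcongr
          _ = _ := by ring
      have f3 : 2 * a * r * (-(n * (4 / ‖x₀‖ * S * V))) = r * (-(V * (8 * a * n * S / ‖x₀‖))) := by
        ring
      nlinarith
    exact le_of_mul_le_mul_left e6 hr0
  have hmv := (convex_Icc (0:ℝ) ρ).mul_sub_le_image_sub_of_le_deriv (f := B)
    (fun r _ => (hBd r).continuousAt.continuousWithinAt)
    (fun r _ => (hBd r).differentiableAt.differentiableWithinAt)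
    (by rw [interior_Icc]; exact hder) 0 (by simp [hρ.le]) ρ (by simp [hρ.le]) hρ.le
  have hB0 : B 0 = g x₀ * ∫ y : 𝔼 n, qtent y := by
    simp only [hB, zero_smul, add_zero]
    rw [integral_const_mul]
  rw [← hB0]
  have : V * (8 * a * n * (ρ / ‖x₀‖) * S + ρ ^ 2 * N₀)
      = (V * (8 * a * n * S / ‖x₀‖ + ρ * N₀)) * (ρ - 0) := by ring
  rw [this]
  linarith

theorem abs_fderiv_single_le {n : ℕ} (L : (𝔼 n) →L[ℝ] ℝ) (i : Fin n) :
    |L (EuclideanSpace.single i 1)| ≤ ‖L‖ := by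
  simpa using L.le_opNorm (EuclideanSpace.single i (1:ℝ))

theorem integral_le_setIntegral_closedBall {n : ℕ} {F G : (𝔼 n) → ℝ} (R : ℝ) (hF : Continuous F)
    (hG : Continuous G) (h0 : ∀ y, R < ‖y‖ → F y = 0) (hFG : ∀ y, ‖y‖ ≤ R → F y ≤ G y) :
    ∫ y, F y ≤ ∫ y in Metric.closedBall (0 : 𝔼 n) R, G y := by
  have hs : ∫ y in Metric.closedBall (0 : 𝔼 n) R, F y = ∫ y, F y := by
    refine setIntegral_eq_integral_of_forall_compl_eq_zero fun y hy => h0 y ?_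
    simpa using hy
  rw [← hs]
  refine setIntegral_mono_on (hF.continuousOn.integrableOn_compact (isCompact_closedBall _ _))
    (hG.continuousOn.integrableOn_compact (isCompact_closedBall _ _)) measurableSet_closedBall
    fun y hy => hFG y (by simpa using hy)

/-- Testing a differential inequality against a bump bounds the source by the gradient. -/
theorem setIntegral_source_le {n : ℕ} {h f : (𝔼 n) → ℝ} (hh : ContDiff ℝ 2 h) (hf : Continuous f)
    {q : ℝ} (hq : 0 ≤ q) (hf0 : ∀ y, ‖y‖ ≤ 2 → 0 ≤ f y)
    (hL : ∀ y, ‖y‖ ≤ 2 → q * f y ≤ -lapl h y + ‖fderiv ℝ h y‖) :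
    q * (9 / 64) * (∫ y in Metric.closedBall (0 : 𝔼 n) 1, f y) ≤
      (n + 1) * ∫ y in Metric.closedBall (0 : 𝔼 n) 2, ‖fderiv ℝ h y‖ := by
  set ζ : (𝔼 n) → ℝ := fun y => qbump (0 + (1 / 2 : ℝ) • y) with hζ
  have hζc : ContDiff ℝ 1 ζ := contDiff_qbump.comp (by fun_prop)
  have hζ0 (y : 𝔼 n) (hy : 2 ≤ ‖y‖) : ζ y = 0 := by
    refine qbump_eq_zero ?_
    rw [zero_add, norm_smul]; norm_num; linarith
  have hζs : HasCompactSupport ζ := hasCompactSupport_of_eq_zero 2 hζ0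
  have hζnn (y) : 0 ≤ ζ y := qbump_nonneg _
  have hζ1 (y) : ζ y ≤ 1 := qbump_le_one _
  have hζ' (y v : 𝔼 n) : fderiv ℝ ζ y v
      = (1/2) * fderiv ℝ (qbump (n := n)) (0 + (1 / 2 : ℝ) • y) v := by
    simp only [hζ]
    rw [fderiv_comp_affine (g := qbump) 0 (1/2) y]; simp
  have hζlow (y : 𝔼 n) (hy : ‖y‖ ≤ 1) : 9 / 64 ≤ ζ y := by
    have h1 : ‖(0 : 𝔼 n) + (1 / 2 : ℝ) • y‖ = ‖y‖ / 2 := by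
      rw [zero_add, norm_smul]; norm_num; ring
    have h2 : 3 / 4 ≤ qtent ((0 : 𝔼 n) + (1 / 2 : ℝ) • y) := by
      unfold qtent; rw [h1]
      refine le_max_of_le_right ?_
      nlinarith [norm_nonneg y]
    simp only [hζ]; rw [qbump_eq]
    nlinarith
  have cgrad : Continuous fun y => ‖fderiv ℝ h y‖ := (hh.continuous_fderiv (by norm_num)).norm
  have cζ := hζc.continuous
  have clap := continuous_lapl hh
  have cs {F : (𝔼 n) → ℝ} (hF : Continuous F) : Integrable fun y => ζ y * F y :=
    (cζ.mul hF).integrable_of_hasCompactSupport hζs.mul_right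
  -- lower bound
  have s1 : q * (9 / 64) * (∫ y in Metric.closedBall (0 : 𝔼 n) 1, f y) ≤ ∫ y, ζ y * (q * f y) := by
    have i1 := cs (continuous_const.mul hf : Continuous fun y => q * f y)
    have nn : ∀ y, 0 ≤ ζ y * (q * f y) := by
      intro y
      rcases le_or_gt ‖y‖ 2 with hy | hy
      · exact mul_nonneg (hζnn y) (mul_nonneg hq (hf0 y hy))
      · simp [hζ0 y hy.le]
    rw [← integral_const_mul]
    refine le_trans ?_ (setIntegral_le_integral (s := Metric.closedBall (0 : 𝔼 n) 1) i1
      (Eventually.of_forall nn))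
    refine setIntegral_mono_on ?_ i1.integrableOn measurableSet_closedBall fun y hy => ?_
    · exact (continuous_const.mul hf).continuousOn.integrableOn_compact (isCompact_closedBall _ _)
    · have hy : ‖y‖ ≤ 1 := by simpa using hy
      have := mul_le_mul_of_nonneg_right (hζlow y hy) (mul_nonneg hq (hf0 y (by linarith)))
      linarith
  have s2 : ∫ y, ζ y * (q * f y) ≤ ∫ y, ζ y * (-lapl h y + ‖fderiv ℝ h y‖) := by
    refine integral_mono (cs (by fun_prop)) (cs (clap.neg.add cgrad)) fun y => ?_
    simp only
    rcases le_or_gt ‖y‖ 2 with hy | hy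
    · exact mul_le_mul_of_nonneg_left (hL y hy) (hζnn y)
    · simp [hζ0 y hy.le]
  have s3 : ∫ y, ζ y * (-lapl h y + ‖fderiv ℝ h y‖) = ∫ y, ((∑ i : Fin n,
      fderiv ℝ ζ y (EuclideanSpace.single i 1) * fderiv ℝ h y (EuclideanSpace.single i 1))
        + ζ y * ‖fderiv ℝ h y‖) := by
    have e1 := integral_mul_lapl hζc hζs hh
    have i2 : Integrable fun y => ∑ i : Fin n,
        fderiv ℝ ζ y (EuclideanSpace.single i 1) * fderiv ℝ h y (EuclideanSpace.single i 1) := by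
      refine integrable_finsetSum _ fun i _ => ?_
      exact (((hζc.continuous_fderiv (by norm_num)).clm_apply continuous_const).mul
        (contDiff_fderiv_apply hh _).continuous).integrable_of_hasCompactSupport
        (hζs.fderiv_apply (𝕜 := ℝ) _).mul_right
    have i3 : Integrable fun y => -(ζ y * lapl h y) := (cs clap).neg
    rw [integral_add i2 (cs cgrad), ← neg_eq_iff_eq_neg.2 e1, ← integral_neg,
      ← integral_add i3 (cs cgrad)]
    refine integral_congr_ae (Eventually.of_forall fun y => ?_)
    simp only; ring
  have s4 : ∫ y, ((∑ i : Fin n,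
      fderiv ℝ ζ y (EuclideanSpace.single i 1) * fderiv ℝ h y (EuclideanSpace.single i 1))
        + ζ y * ‖fderiv ℝ h y‖) ≤
      ∫ y in Metric.closedBall (0 : 𝔼 n) 2, (n + 1) * ‖fderiv ℝ h y‖ := by
    refine integral_le_setIntegral_closedBall 2 ?_ (by fun_prop) (fun y hy => ?_) (fun y hy => ?_)
    · refine (continuous_finsetSum _ fun i _ => ?_).add (cζ.mul cgrad)
      exact ((hζc.continuous_fderiv (by norm_num)).clm_apply continuous_const).mul
        (contDiff_fderiv_apply hh _).continuous
    · have hn : 1 ≤ ‖(0 : 𝔼 n) + (1 / 2 : ℝ) • y‖ := by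
        rw [zero_add, norm_smul]; norm_num; linarith
      rw [hζ0 y hy.le, zero_mul, add_zero]
      refine Finset.sum_eq_zero fun i _ => ?_
      rw [hζ', fderiv_qbump, qtent_eq_zero hn]
      simp
    · have : ∑ i : Fin n, fderiv ℝ ζ y (EuclideanSpace.single i 1) *
          fderiv ℝ h y (EuclideanSpace.single i 1) ≤ ∑ i : Fin n, ‖fderiv ℝ h y‖ := by
        refine Finset.sum_le_sum fun i _ => (le_abs_self _).trans ?_
        rw [abs_mul]
        have b1 : |fderiv ℝ ζ y (EuclideanSpace.single i 1)| ≤ 1 := by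
          rw [hζ', abs_mul]
          have := abs_fderiv_qbump_le (0 + (1 / 2 : ℝ) • y) (EuclideanSpace.single i 1) (by simp)
          rw [abs_of_pos (by norm_num : (0:ℝ) < 1/2)]
          linarith
        calc _ ≤ 1 * ‖fderiv ℝ h y‖ := mul_le_mul b1 (abs_fderiv_single_le _ i) (abs_nonneg _)
              (by norm_num)
          _ = _ := one_mul _
      simp at this
      have h2 := mul_le_mul_of_nonneg_right (hζ1 y) (norm_nonneg (fderiv ℝ h y))
      linarith
  rw [integral_const_mul] at s4
  linarith

theorem integral_qtent_pos {n : ℕ} : 0 < ∫ y : 𝔼 n, qtent y := by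
  refine (continuous_qtent).integral_pos_of_hasCompactSupport_nonneg_nonzero
    (hasCompactSupport_of_eq_zero 1 fun y hy => qtent_eq_zero hy) (fun y => qtent_nonneg y)
    (x := 0) ?_
  simp [qtent]

set_option maxHeartbeats 2000000 in
/-- A point where a solution is comparable to its nearby supremum carries a definite amount of
Dirichlet energy at the natural scale. -/
theorem local_energy_lower_bound {n : ℕ} {a p M A : ℝ} (ha : 0 ≤ a) (hp : 2 < p) (hM : 1 ≤ M)
    (hA : 1 ≤ A) : ∃ κ : ℝ, 0 < κ ∧ κ ≤ 1 / 8 ∧ ∀ q, 0 < q → q ≤ κ → ∃ θ : ℝ, 0 < θ ∧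
      ∀ (g : (𝔼 n) → ℝ) (x₀ : 𝔼 n) (ρ : ℝ), ContDiff ℝ 2 g → x₀ ≠ 0 → 0 < ρ →
      ρ ≤ κ * ‖x₀‖ → 0 < g x₀ →
      (∀ x, ‖x - x₀‖ ≤ 2 * ρ → 0 ≤ g x ∧ g x ≤ M * g x₀) →
      (∀ x, ‖x - x₀‖ ≤ 2 * ρ →
        q * g x₀ / ρ ^ 2 / A * (g x / g x₀) ^ (p - 1) ≤
          -(lapl g x - 2 * a * (fderiv ℝ g x x / ‖x‖ ^ 2)) ∧
        -(lapl g x - 2 * a * (fderiv ℝ g x x / ‖x‖ ^ 2)) ≤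
          A * (q * g x₀ / ρ ^ 2) * (g x / g x₀) ^ (p - 1)) →
      θ * g x₀ ^ 2 ≤ ρ ^ 2 * ∫ y in Metric.closedBall (0 : 𝔼 n) 2, ‖fderiv ℝ g (x₀ + ρ • y)‖ ^ 2 := by
  set I := ∫ y : 𝔼 n, qtent y with hI
  have hI0 : 0 < I := integral_qtent_pos
  set V := volume.real (Metric.closedBall (0 : 𝔼 n) 1) with hV
  set V₂ := volume.real (Metric.closedBall (0 : 𝔼 n) 2) with hV₂
  have hV0 : 0 ≤ V := measureReal_nonneg
  have hV₂0 : 0 ≤ V₂ := measureReal_nonneg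
  have hMp : 0 < M ^ (p - 1) := by positivity
  set W := V * (8 * a * n * M + A * M ^ (p - 1)) with hW
  have hW0 : 0 ≤ W := by positivity
  set κ := min (1 / 8) (min (I / (2 * (W + 1))) (1 / (4 * (a + 1)))) with hκ
  have hκ0 : 0 < κ := by rw [hκ]; positivity
  have hκ1 : κ ≤ 1 / 8 := min_le_left _ _
  have hκ2 : κ * W ≤ I / 2 := by
    have : κ ≤ I / (2 * (W + 1)) := (min_le_right _ _).trans (min_le_left _ _)
    rw [le_div_iff₀ (by positivity)] at this
    nlinarith
  have hκ3 : 4 * a * κ ≤ 1 := by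
    have : κ ≤ 1 / (4 * (a + 1)) := (min_le_right _ _).trans (min_le_right _ _)
    rw [le_div_iff₀ (by positivity)] at this
    nlinarith
  refine ⟨κ, hκ0, hκ1, fun q hq hqκ => ?_⟩
  set τ := I / (4 * (V + 1)) with hτ
  have hτ0 : 0 < τ := by positivity
  set c := q / A * (9 / 64) * (I / 4 * τ ^ (p - 2)) / (n + 1) with hc
  have hA0 : 0 < A := by linarith
  have hc0 : 0 < c := by positivity
  set s := c / (2 * (V₂ + 1)) with hs
  have hs0 : 0 < s := by positivity
  refine ⟨s * (c / 2), by positivity, fun g x₀ ρ hg hx₀ hρ hρκ hk hgM hP => ?_⟩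
  set k := g x₀ with hkdef
  have hx : 0 < ‖x₀‖ := norm_pos_iff.2 hx₀
  have hratio (x : 𝔼 n) (hx : ‖x - x₀‖ ≤ 2 * ρ) : 0 ≤ g x / k ∧ g x / k ≤ M :=
    ⟨div_nonneg (hgM x hx).1 hk.le, by rw [div_le_iff₀ hk]; exact (hgM x hx).2⟩
  have hin (y : 𝔼 n) (R : ℝ) (hy : ‖y‖ ≤ R) : ‖x₀ + ρ • y - x₀‖ ≤ R * ρ := by
    rw [add_sub_cancel_left, norm_smul, Real.norm_of_nonneg hρ.le]; nlinarith
  -- mean value inequality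
  have mv := le_average_add ha hx₀ (ρ := ρ) (S := M * k) (N₀ := A * (q * k / ρ ^ 2) * M ^ (p - 1))
    hρ (by nlinarith) (by positivity) hg (fun x hx => (hgM x (by linarith)).1)
    (fun x hx => (hgM x (by linarith)).2) (fun x hx => by
      have h1 := (hP x (by linarith)).2
      have h2 := hratio x (by linarith)
      have h3 : A * (q * k / ρ ^ 2) * (g x / k) ^ (p - 1) ≤ A * (q * k / ρ ^ 2) * M ^ (p - 1) := by
        have := h2.1
        gcongr
        · linarith
        · exact h2.2
      linarith)
  have mv2 : k * (I / 2) ≤ ∫ y, g (x₀ + ρ • y) * qtent y := by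
    have e1 : V * (8 * a * n * (ρ / ‖x₀‖) * (M * k) + ρ ^ 2 *
        (A * (q * k / ρ ^ 2) * M ^ (p - 1))) = k * (V * (8 * a * n * M * (ρ / ‖x₀‖)
          + A * M ^ (p - 1) * q)) := by
      field_simp
    have e2 : ρ / ‖x₀‖ ≤ κ := by rwa [div_le_iff₀ hx]
    have e3 : V * (8 * a * n * M * (ρ / ‖x₀‖) + A * M ^ (p - 1) * q) ≤
        V * (8 * a * n * M * κ + A * M ^ (p - 1) * κ) := by gcongr
    have e4 : V * (8 * a * n * M * κ + A * M ^ (p - 1) * κ) = κ * W := by rw [hW]; ring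
    rw [e1] at mv
    have e5 := mul_le_mul_of_nonneg_left (e3.trans (e4.le.trans hκ2)) hk.le
    linarith
  set h : (𝔼 n) → ℝ := fun y => g (x₀ + ρ • y) with hh
  have hhc : ContDiff ℝ 2 h := hg.comp (by fun_prop)
  have ch := hhc.continuous
  set f : (𝔼 n) → ℝ := fun y => (h y / k) ^ (p - 1) with hf
  have cf : Continuous f := (ch.div_const k).rpow_const fun y => Or.inr (by linarith)
  have hfnn (y : 𝔼 n) (hy : ‖y‖ ≤ 2) : 0 ≤ f y :=
    rpow_nonneg (hratio _ (hin y 2 hy)).1 _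
  set Fint := ∫ y in Metric.closedBall (0 : 𝔼 n) 1, f y with hFint
  have lowF : I / 4 * τ ^ (p - 2) ≤ Fint := by
    have t1 : ∫ y, h y * qtent y ≤ ∫ y in Metric.closedBall (0 : 𝔼 n) 1,
        k * (τ + τ ^ (2 - p) * f y) := by
      refine integral_le_setIntegral_closedBall 1 (ch.mul continuous_qtent) (by fun_prop)
        (fun y hy => by simp [qtent_eq_zero hy.le]) fun y hy => ?_
      have r0 := (hratio _ (hin y 2 (by linarith))).1
      have hy0 : 0 ≤ h y := (hgM _ (hin y 2 (by linarith))).1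
      have t2 : h y / k ≤ τ + τ ^ (2 - p) * f y := by
        change 0 ≤ h y / k at r0
        rcases le_total (h y / k) τ with hle | hle
        · have := hfnn y (by linarith)
          have : 0 ≤ τ ^ (2 - p) * f y := by positivity
          linarith
        · have hpos : 0 < h y / k := hτ0.trans_le hle
          have : h y / k ≤ τ ^ (2 - p) * f y := by
            have e1 : f y = (h y / k) ^ (p - 2) * (h y / k) := by
              simp only [hf]
              rw [← rpow_add_one hpos.ne']; ring_nf
            have e2 : τ ^ (p - 2) ≤ (h y / k) ^ (p - 2) := by gcongr
            have e3 : τ ^ (2 - p) * τ ^ (p - 2) = 1 := by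
              rw [← rpow_add hτ0]; simp
            calc h y / k = τ ^ (2 - p) * (τ ^ (p - 2) * (h y / k)) := by
                  rw [← mul_assoc, e3, one_mul]
              _ ≤ τ ^ (2 - p) * ((h y / k) ^ (p - 2) * (h y / k)) := by gcongr
              _ = _ := by rw [e1]
          linarith
      calc h y * qtent y ≤ h y * 1 := by gcongr; exact qtent_le_one y
        _ = k * (h y / k) := by field_simp
        _ ≤ _ := by gcongr
    have if1 : IntegrableOn f (Metric.closedBall (0 : 𝔼 n) 1) :=
      cf.continuousOn.integrableOn_compact (isCompact_closedBall _ _)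
    rw [integral_const_mul, integral_add (continuous_const.continuousOn.integrableOn_compact
      (isCompact_closedBall _ _)) (if1.const_mul _),
      integral_const_mul, setIntegral_const, smul_eq_mul] at t1
    have t3 := le_of_mul_le_mul_left (mv2.trans t1) hk
    have t4 : V * τ ≤ I / 4 := by
      rw [hτ, mul_div_assoc', div_le_div_iff₀ (by positivity) (by norm_num)]
      nlinarith
    have t5 : I / 4 ≤ τ ^ (2 - p) * Fint := by linarith
    calc I / 4 * τ ^ (p - 2) ≤ (τ ^ (2 - p) * Fint) * τ ^ (p - 2) := by gcongr
      _ = (τ ^ (2 - p) * τ ^ (p - 2)) * Fint := by ring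
      _ = Fint := by rw [← rpow_add hτ0]; simp
  have src := setIntegral_source_le hhc cf (q := q * k / A) (by positivity) hfnn (fun y hy => by
    have h1 := (hP _ (hin y 2 hy)).1
    have hge : ‖x₀‖ / 2 ≤ ‖x₀ + ρ • y‖ := norm_affine_ge hρ.le (by nlinarith)
    simp only [hh]
    rw [lapl_comp_affine hg, fderiv_comp_affine, norm_smul, Real.norm_of_nonneg hρ.le]
    set x := x₀ + ρ • y
    have hxp : 0 < ‖x‖ := by linarith
    have h2 : |fderiv ℝ g x x / ‖x‖ ^ 2| ≤ ‖fderiv ℝ g x‖ / ‖x‖ := by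
      rw [abs_div, abs_of_pos (a := ‖x‖ ^ 2) (by positivity), div_le_div_iff₀ (by positivity) hxp]
      have := (fderiv ℝ g x).le_opNorm x
      rw [Real.norm_eq_abs] at this
      nlinarith
    have h3 : ρ * (2 * a * (‖fderiv ℝ g x‖ / ‖x‖)) ≤ ‖fderiv ℝ g x‖ := by
      have : ρ * (2 * a) ≤ ‖x‖ := by
        calc ρ * (2 * a) ≤ κ * ‖x₀‖ * (2 * a) := by gcongr
          _ = 4 * a * κ * (‖x₀‖ / 2) := by ring
          _ ≤ 1 * (‖x₀‖ / 2) := by gcongr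
          _ ≤ ‖x‖ := by linarith
      calc ρ * (2 * a * (‖fderiv ℝ g x‖ / ‖x‖)) = (ρ * (2 * a)) * ‖fderiv ℝ g x‖ / ‖x‖ := by ring
        _ ≤ ‖x‖ * ‖fderiv ℝ g x‖ / ‖x‖ := by gcongr
        _ = _ := by field_simp
    have h4 := mul_le_mul_of_nonneg_left h1 (sq_nonneg ρ)
    have h5 : ρ ^ 2 * (q * k / ρ ^ 2 / A * (g x / k) ^ (p - 1)) = q * k / A * f y := by
      simp only [hf, hh]; field_simp; rfl
    rw [h5] at h4
    have h6 : ρ ^ 2 * (2 * a * (fderiv ℝ g x x / ‖x‖ ^ 2)) ≤ ρ * ‖fderiv ℝ g x‖ := by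
      calc _ ≤ ρ ^ 2 * (2 * a * (‖fderiv ℝ g x‖ / ‖x‖)) := by
            refine mul_le_mul_of_nonneg_left ?_ (sq_nonneg ρ)
            exact mul_le_mul_of_nonneg_left ((le_abs_self _).trans h2) (by positivity)
        _ = ρ * (ρ * (2 * a * (‖fderiv ℝ g x‖ / ‖x‖))) := by ring
        _ ≤ _ := by gcongr
    linarith)
  set D := ∫ y in Metric.closedBall (0 : 𝔼 n) 2, ‖fderiv ℝ h y‖ with hD
  have lowD : c * k ≤ D := by
    have h1 : q * k / A * (9 / 64) * (I / 4 * τ ^ (p - 2)) ≤ (n + 1) * D :=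
      (mul_le_mul_of_nonneg_left lowF (by positivity)).trans src
    have h2 : c * k = q * k / A * (9 / 64) * (I / 4 * τ ^ (p - 2)) / (n + 1) := by rw [hc]; ring
    rw [h2, div_le_iff₀ (by positivity)]
    linarith
  have cg : Continuous fun y => ‖fderiv ℝ h y‖ := (hhc.continuous_fderiv (by norm_num)).norm
  set Q := ∫ y in Metric.closedBall (0 : 𝔼 n) 2, ‖fderiv ℝ h y‖ ^ 2 with hQ
  have upD : D ≤ s * k * V₂ + (s * k)⁻¹ * Q := by
    have ig : IntegrableOn (fun y => ‖fderiv ℝ h y‖ ^ 2) (Metric.closedBall (0 : 𝔼 n) 2) :=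
      (cg.pow 2).continuousOn.integrableOn_compact (isCompact_closedBall _ _)
    have e1 : D ≤ ∫ y in Metric.closedBall (0 : 𝔼 n) 2,
        (s * k + (s * k)⁻¹ * ‖fderiv ℝ h y‖ ^ 2) := by
      refine setIntegral_mono_on (cg.continuousOn.integrableOn_compact (isCompact_closedBall _ _))
        ((by fun_prop : Continuous fun y => s * k + (s * k)⁻¹ *
          ‖fderiv ℝ h y‖ ^ 2).continuousOn.integrableOn_compact (isCompact_closedBall _ _))
        measurableSet_closedBall fun y _ => ?_
      have hsk : 0 < s * k := by positivity
      set t := ‖fderiv ℝ h y‖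
      have ht : 0 ≤ t := norm_nonneg _
      rw [← sub_nonneg]
      have : s * k + (s * k)⁻¹ * t ^ 2 - t = (s * k)⁻¹ * ((s * k) ^ 2 + t ^ 2 - s * k * t) := by
        field_simp
      rw [this]
      have : 0 ≤ (s * k) ^ 2 + t ^ 2 - s * k * t := by nlinarith [sq_nonneg (s * k - t)]
      positivity
    rw [integral_add (continuous_const.continuousOn.integrableOn_compact
      (isCompact_closedBall _ _)) (ig.const_mul _), setIntegral_const, smul_eq_mul,
      integral_const_mul] at e1
    linarith
  have hQ2 : Q = ρ ^ 2 * ∫ y in Metric.closedBall (0 : 𝔼 n) 2, ‖fderiv ℝ g (x₀ + ρ • y)‖ ^ 2 := by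
    rw [hQ, ← integral_const_mul]
    refine integral_congr_ae (Eventually.of_forall fun y => ?_)
    simp only [hh]
    rw [fderiv_comp_affine, norm_smul, Real.norm_of_nonneg hρ.le, mul_pow]
  rw [← hQ2]
  have hsV : s * V₂ ≤ c / 2 := by
    rw [hs, div_mul_eq_mul_div, div_le_div_iff₀ (by positivity) (by norm_num)]
    nlinarith
  have h1 : c / 2 * k ≤ (s * k)⁻¹ * Q := by nlinarith
  have hsk : 0 < s * k := by positivity
  calc s * (c / 2) * k ^ 2 = (s * k) * (c / 2 * k) := by ring
    _ ≤ (s * k) * ((s * k)⁻¹ * Q) := by gcongr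
    _ = Q := by field_simp

/-- The operator `-|x|^(2a) div(|x|^(-2a) ∇·)`. -/
def wop {n : ℕ} (a : ℝ) (w : (𝔼 n) → ℝ) (x : 𝔼 n) : ℝ :=
  -(lapl w x - 2 * a * (fderiv ℝ w x x / ‖x‖ ^ 2))

theorem differentiableAt_fderiv_apply {n : ℕ} {w : (𝔼 n) → ℝ} {x : 𝔼 n} (hw : ContDiffAt ℝ 2 w x)
    (v : 𝔼 n) : DifferentiableAt ℝ (fun y => fderiv ℝ w y v) x :=
  ((hw.fderiv_right (m := 1) (by norm_num)).differentiableAt (by norm_num)).clm_apply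
    (differentiableAt_const _)

theorem ContDiffAt.eventually_differentiableAt {n : ℕ} {w : (𝔼 n) → ℝ} {x : 𝔼 n}
    (hw : ContDiffAt ℝ 2 w x) : ∀ᶠ y in 𝓝 x, DifferentiableAt ℝ w y :=
  (hw.eventually (by simp)).mono fun _ h => h.differentiableAt (by norm_num)

theorem lapl_congr {n : ℕ} {w z : (𝔼 n) → ℝ} {x : 𝔼 n} (h : w =ᶠ[𝓝 x] z) : lapl w x = lapl z x := by
  unfold lapl
  refine Finset.sum_congr rfl fun i _ => ?_
  have : (fun y => fderiv ℝ w y (EuclideanSpace.single i 1)) =ᶠ[𝓝 x]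
      fun y => fderiv ℝ z y (EuclideanSpace.single i 1) := by
    filter_upwards [h.fderiv (𝕜 := ℝ)] with y hy
    rw [hy]
  rw [this.fderiv_eq]

theorem wop_congr {n : ℕ} {a : ℝ} {w z : (𝔼 n) → ℝ} {x : 𝔼 n} (h : w =ᶠ[𝓝 x] z) :
    wop a w x = wop a z x := by
  unfold wop; rw [lapl_congr h, h.fderiv_eq]

theorem lapl_add {n : ℕ} {w z : (𝔼 n) → ℝ} {x : 𝔼 n} (hw : ContDiffAt ℝ 2 w x)
    (hz : ContDiffAt ℝ 2 z x) : lapl (fun y => w y + z y) x = lapl w x + lapl z x := by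
  unfold lapl
  rw [← Finset.sum_add_distrib]
  refine Finset.sum_congr rfl fun i _ => ?_
  have : (fun y => fderiv ℝ (fun y => w y + z y) y (EuclideanSpace.single i 1)) =ᶠ[𝓝 x]
      fun y => fderiv ℝ w y (EuclideanSpace.single i 1)
        + fderiv ℝ z y (EuclideanSpace.single i 1) := by
    filter_upwards [hw.eventually_differentiableAt, hz.eventually_differentiableAt] with y h1 h2
    rw [fderiv_fun_add h1 h2]; rfl
  rw [this.fderiv_eq, fderiv_fun_add (differentiableAt_fderiv_apply hw _)
    (differentiableAt_fderiv_apply hz _)]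
  rfl

theorem lapl_const_mul {n : ℕ} {w : (𝔼 n) → ℝ} {x : 𝔼 n} (hw : ContDiffAt ℝ 2 w x) (c : ℝ) :
    lapl (fun y => c * w y) x = c * lapl w x := by
  unfold lapl
  rw [Finset.mul_sum]
  refine Finset.sum_congr rfl fun i _ => ?_
  have : (fun y => fderiv ℝ (fun y => c * w y) y (EuclideanSpace.single i 1)) =ᶠ[𝓝 x]
      fun y => c * fderiv ℝ w y (EuclideanSpace.single i 1) := by
    filter_upwards [hw.eventually_differentiableAt] with y h1
    rw [fderiv_const_mul h1]; rfl
  rw [this.fderiv_eq, fderiv_const_mul (differentiableAt_fderiv_apply hw _)]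
  rfl

theorem wop_add {n : ℕ} {a : ℝ} {w z : (𝔼 n) → ℝ} {x : 𝔼 n} (hw : ContDiffAt ℝ 2 w x)
    (hz : ContDiffAt ℝ 2 z x) : wop a (fun y => w y + z y) x = wop a w x + wop a z x := by
  unfold wop
  rw [lapl_add hw hz, fderiv_fun_add (hw.differentiableAt (by norm_num))
    (hz.differentiableAt (by norm_num))]
  simp only [add_apply]; ring

theorem wop_const_mul {n : ℕ} {a : ℝ} {w : (𝔼 n) → ℝ} {x : 𝔼 n} (hw : ContDiffAt ℝ 2 w x)
    (c : ℝ) : wop a (fun y => c * w y) x = c * wop a w x := by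
  unfold wop
  rw [lapl_const_mul hw, fderiv_const_mul (hw.differentiableAt (by norm_num))]
  simp only [smul_apply, smul_eq_mul]; ring

theorem wop_const {n : ℕ} {a : ℝ} (c : ℝ) (x : 𝔼 n) : wop a (fun _ => c) x = 0 := by
  simp [wop, lapl]

theorem wop_eq_wdiv {n : ℕ} {a : ℝ} (w : (𝔼 n) → ℝ) {x : 𝔼 n} (hx : x ≠ 0) :
    wop a w x = ‖x‖ ^ (2 * a) * -(wdiv a w x) := by
  have h0 : 0 < ‖x‖ := norm_pos_iff.2 hx
  have h1 : inner ℝ x (gradient w x) = fderiv ℝ w x x := by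
    rw [real_inner_comm]; unfold gradient
    rw [InnerProductSpace.toDual_symm_apply]
  have h2 : ‖x‖ ^ (2 * a) * ‖x‖ ^ (-(2 * a)) = 1 := by
    rw [← rpow_add h0]; simp
  unfold wop wdiv
  rw [h1, mul_neg, ← mul_assoc, h2]
  ring

theorem wop_add_bounds {n : ℕ} {a b p ν α β : ℝ} (hν : 0 < ν) (hα : 1 < α) (hβ : 1 < β)
    (hαβ : α + β = p) {u v : (𝔼 n) → ℝ}
    (hu : ContDiffOn ℝ 2 u {0}ᶜ) (hv : ContDiffOn ℝ 2 v {0}ᶜ)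
    (hupos : ∀ x : 𝔼 n, x ≠ 0 → 0 < u x) (hvpos : ∀ x : 𝔼 n, x ≠ 0 → 0 < v x)
    (hueq : ∀ x : 𝔼 n, x ≠ 0 →
      -(wdiv a u x) = ‖x‖ ^ (-(b*p)) * (u x ^ (p-1) + ν*α * u x ^ (α-1) * v x ^ β))
    (hveq : ∀ x : 𝔼 n, x ≠ 0 →
      -(wdiv a v x) = ‖x‖ ^ (-(b*p)) * (v x ^ (p-1) + ν*β * u x ^ α * v x ^ (β-1))) :
    ∃ A : ℝ, 1 ≤ A ∧ ∀ x : 𝔼 n, x ≠ 0 →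
      ‖x‖ ^ (2 * a - b * p) / A * (u x + v x) ^ (p - 1) ≤ wop a (fun y => u y + v y) x ∧
      wop a (fun y => u y + v y) x ≤ A * ‖x‖ ^ (2 * a - b * p) * (u x + v x) ^ (p - 1) := by
  have hp1 : 0 ≤ p - 1 := by linarith
  have h2p : 1 ≤ (2:ℝ) ^ (p - 1) := one_le_rpow (by norm_num) hp1
  have hA1 : 2 + ν * p ≤ 2 + ν * p + 2 ^ (p - 1) := by linarith
  have hνp : 0 < ν * p := mul_pos hν (by linarith)
  refine ⟨2 + ν * p + 2 ^ (p - 1), by linarith, fun x hx => ?_⟩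
  have h0 : 0 < ‖x‖ := norm_pos_iff.2 hx
  have hU := hupos x hx
  have hV := hvpos x hx
  have nb : ({0}ᶜ : Set (𝔼 n)) ∈ 𝓝 x := isOpen_compl_singleton.mem_nhds hx
  rw [wop_add (hu.contDiffAt nb) (hv.contDiffAt nb), wop_eq_wdiv _ hx, wop_eq_wdiv _ hx,
    hueq x hx, hveq x hx]
  have hN : ‖x‖ ^ (2 * a - b * p) = ‖x‖ ^ (2 * a) * ‖x‖ ^ (-(b * p)) := by
    rw [← rpow_add h0]; ring_nf
  set N := ‖x‖ ^ (2 * a - b * p) with hNd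
  have hN0 : 0 < N := rpow_pos_of_pos h0 _
  set U := u x
  set W := v x
  have e : ‖x‖ ^ (2 * a) * (‖x‖ ^ (-(b*p)) * (U ^ (p-1) + ν*α * U ^ (α-1) * W ^ β)) +
      ‖x‖ ^ (2 * a) * (‖x‖ ^ (-(b*p)) * (W ^ (p-1) + ν*β * U ^ α * W ^ (β-1))) =
      N * ((U ^ (p-1) + W ^ (p-1)) + (ν*α * (U ^ (α-1) * W ^ β) + ν*β * (U ^ α * W ^ (β-1)))) := by
    rw [hN]; ring
  rw [e]
  set A := 2 + ν * p + 2 ^ (p - 1)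
  have c1 : 0 ≤ U ^ (α-1) * W ^ β := by positivity
  have c2 : 0 ≤ U ^ α * W ^ (β-1) := by positivity
  have hα0 : 0 < α := by linarith
  have hβ0 : 0 < β := by linarith
  have hA0 : 0 < A := by linarith
  constructor
  · have k1 : (U + W) ^ (p - 1) ≤ 2 ^ (p - 1) * (U ^ (p-1) + W ^ (p-1)) := by
      rcases le_total U W with h | h
      · calc (U + W) ^ (p - 1) ≤ (2 * W) ^ (p - 1) := by gcongr; linarith
          _ = 2 ^ (p - 1) * W ^ (p - 1) := mul_rpow (by norm_num) hV.le
          _ ≤ _ := by gcongr; linarith [rpow_pos_of_pos hU (p - 1)]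
      · calc (U + W) ^ (p - 1) ≤ (2 * U) ^ (p - 1) := by gcongr; linarith
          _ = 2 ^ (p - 1) * U ^ (p - 1) := mul_rpow (by norm_num) hU.le
          _ ≤ _ := by gcongr; linarith [rpow_pos_of_pos hV (p - 1)]
    have k2 : (U + W) ^ (p - 1) / A ≤ U ^ (p-1) + W ^ (p-1) := by
      rw [div_le_iff₀ hA0]
      refine k1.trans ?_
      rw [mul_comm]
      gcongr
      linarith
    calc N / A * (U + W) ^ (p - 1) = N * ((U + W) ^ (p - 1) / A) := by ring
      _ ≤ N * (U ^ (p-1) + W ^ (p-1)) := by gcongr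
      _ ≤ _ := by
        refine mul_le_mul_of_nonneg_left ?_ hN0.le
        have := add_nonneg (mul_nonneg (mul_pos hν hα0).le c1) (mul_nonneg (mul_pos hν hβ0).le c2)
        linarith
  · have hS : 0 < U + W := by linarith
    have d1 : U ^ (p-1) ≤ (U + W) ^ (p-1) := by gcongr; linarith
    have d2 : W ^ (p-1) ≤ (U + W) ^ (p-1) := by gcongr; linarith
    have d3 : U ^ (α-1) * W ^ β ≤ (U + W) ^ (p-1) := by
      calc U ^ (α-1) * W ^ β ≤ (U + W) ^ (α-1) * (U + W) ^ β := by
            gcongr <;> linarith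
        _ = _ := by rw [← rpow_add hS, ← hαβ]; ring_nf
    have d4 : U ^ α * W ^ (β-1) ≤ (U + W) ^ (p-1) := by
      calc U ^ α * W ^ (β-1) ≤ (U + W) ^ α * (U + W) ^ (β-1) := by
            gcongr <;> linarith
        _ = _ := by rw [← rpow_add hS, ← hαβ]; ring_nf
    have d5 : 0 < (U + W) ^ (p-1) := by positivity
    calc _ ≤ N * (((U + W) ^ (p-1) + (U + W) ^ (p-1)) +
          (ν*α * (U + W) ^ (p-1) + ν*β * (U + W) ^ (p-1))) := by gcongr
      _ = (2 + ν * p) * N * (U + W) ^ (p-1) := by rw [← hαβ]; ring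
      _ ≤ _ := by gcongr

theorem norm_gradient {n : ℕ} (w : (𝔼 n) → ℝ) (x : 𝔼 n) : ‖gradient w x‖ = ‖fderiv ℝ w x‖ := by
  unfold gradient; simp

/-- A finite-energy dominating density for the sum of two finite-energy functions. -/
theorem exists_energy_density {n : ℕ} {a : ℝ} {u v : (𝔼 n) → ℝ}
    (hu : ContDiffOn ℝ 2 u {0}ᶜ) (hv : ContDiffOn ℝ 2 v {0}ᶜ) (hEu : finiteEnergy a u)
    (hEv : finiteEnergy a v) : ∃ G : (𝔼 n) → ℝ, Integrable G ∧ (∀ x, 0 ≤ G x) ∧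
      ∀ x, x ≠ 0 → ‖x‖ ^ (-(2 * a)) * ‖fderiv ℝ (fun y => u y + v y) x‖ ^ 2 ≤ G x := by
  refine ⟨fun x => 2 * (‖x‖ ^ (-(2*a)) * ‖gradient u x‖^2) + 2 * (‖x‖ ^ (-(2*a)) * ‖gradient v x‖^2),
    (hEu.const_mul 2).add (hEv.const_mul 2), fun x => by positivity, fun x hx => ?_⟩
  have nb : ({0}ᶜ : Set (𝔼 n)) ∈ 𝓝 x := isOpen_compl_singleton.mem_nhds hx
  rw [fderiv_fun_add ((hu.contDiffAt nb).differentiableAt (by norm_num))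
    ((hv.contDiffAt nb).differentiableAt (by norm_num))]
  simp only [norm_gradient]
  have h1 := norm_add_le (fderiv ℝ u x) (fderiv ℝ v x)
  set s := ‖fderiv ℝ u x‖
  set t := ‖fderiv ℝ v x‖
  have h2 : ‖fderiv ℝ u x + fderiv ℝ v x‖ ^ 2 ≤ 2 * s ^ 2 + 2 * t ^ 2 := by
    have := pow_le_pow_left₀ (norm_nonneg _) h1 2
    nlinarith [sq_nonneg (s - t)]
  calc _ ≤ ‖x‖ ^ (-(2*a)) * (2 * s ^ 2 + 2 * t ^ 2) := by gcongr
    _ = _ := by ring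

theorem setIntegral_comp_affine {n : ℕ} (F : (𝔼 n) → ℝ) (x₀ : 𝔼 n) {ρ : ℝ} (hρ : 0 < ρ) (R : ℝ) :
    ∫ y in Metric.closedBall (0 : 𝔼 n) R, F (x₀ + ρ • y) =
      (ρ ^ n)⁻¹ * ∫ x in Metric.closedBall x₀ (R * ρ), F x := by
  rw [← integral_indicator measurableSet_closedBall, ← integral_indicator measurableSet_closedBall]
  set H := (Metric.closedBall x₀ (R * ρ)).indicator F with hH
  have h1 : (Metric.closedBall (0 : 𝔼 n) R).indicator (fun y => F (x₀ + ρ • y)) =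
      fun y => H (x₀ + ρ • y) := by
    funext y
    have : y ∈ Metric.closedBall (0 : 𝔼 n) R ↔ x₀ + ρ • y ∈ Metric.closedBall x₀ (R * ρ) := by
      rw [mem_closedBall_zero_iff, mem_closedBall_iff_norm, add_sub_cancel_left, norm_smul,
        Real.norm_of_nonneg hρ.le, mul_comm ρ, mul_le_mul_iff_left₀ hρ]
    by_cases hy : y ∈ Metric.closedBall (0 : 𝔼 n) R
    · rw [Set.indicator_of_mem hy, hH, Set.indicator_of_mem (this.1 hy)]
    · rw [Set.indicator_of_notMem hy, hH, Set.indicator_of_notMem (fun h => hy (this.2 h))]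
  rw [h1]
  have h2 := Measure.integral_comp_smul (volume : Measure (𝔼 n)) (fun z => H (x₀ + z)) ρ
  rw [h2, integral_add_left_eq_self H x₀]
  simp [abs_of_pos (pow_pos hρ n)]

/-- A function which is `C²` off the origin agrees on a ball with a global `C²` function. -/
theorem exists_contDiff_eq_on_ball {n : ℕ} {w : (𝔼 n) → ℝ} (hw : ContDiffOn ℝ 2 w {0}ᶜ) {x₀ : 𝔼 n}
    {r s : ℝ} (hr : 0 < r) (hrs : r < s) (hs : s < ‖x₀‖) :
    ∃ g : (𝔼 n) → ℝ, ContDiff ℝ 2 g ∧ ∀ x, ‖x - x₀‖ < r → g =ᶠ[𝓝 x] w := by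
  let χ : ContDiffBump x₀ := ⟨r, s, hr, hrs⟩
  refine ⟨fun x => χ x * w x, contDiff_iff_contDiffAt.2 fun x => ?_, fun x hx => ?_⟩
  · by_cases hx : x = 0
    · have h0 : ∀ᶠ y in 𝓝 x, χ y * w y = 0 := by
        have : ∀ᶠ y in 𝓝 x, y ∈ (Metric.closedBall x₀ s)ᶜ := by
          refine Metric.isClosed_closedBall.isOpen_compl.mem_nhds ?_
          simp [hx, hs]
        filter_upwards [this] with y hy
        have : χ y = 0 := χ.zero_of_le_dist (le_of_not_ge fun h => hy h)
        rw [this, zero_mul]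
      exact contDiffAt_const.congr_of_eventuallyEq h0
    · exact χ.contDiff.contDiffAt.mul (hw.contDiffAt (isOpen_compl_singleton.mem_nhds hx))
  · have : χ =ᶠ[𝓝 x] 1 := χ.eventuallyEq_one_of_mem_ball (by simpa [dist_eq_norm] using hx)
    filter_upwards [this] with y hy
    rw [hy]; simp

theorem punctured_local_energy_lower_bound {n : ℕ} {a p M A : ℝ} (ha : 0 ≤ a) (hp : 2 < p)
    (hM : 1 ≤ M) (hA : 1 ≤ A) : ∃ κ : ℝ, 0 < κ ∧ κ ≤ 1 / 8 ∧ ∀ q, 0 < q → q ≤ κ → ∃ θ : ℝ, 0 < θ ∧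
      ∀ (w : (𝔼 n) → ℝ) (x₀ : 𝔼 n) (ρ : ℝ), ContDiffOn ℝ 2 w {0}ᶜ → x₀ ≠ 0 → 0 < ρ →
      ρ ≤ κ * ‖x₀‖ → 0 < w x₀ →
      (∀ x, ‖x - x₀‖ ≤ 2 * ρ → 0 ≤ w x ∧ w x ≤ M * w x₀) →
      (∀ x, ‖x - x₀‖ ≤ 2 * ρ →
        q * w x₀ / ρ ^ 2 / A * (w x / w x₀) ^ (p - 1) ≤ wop a w x ∧
        wop a w x ≤ A * (q * w x₀ / ρ ^ 2) * (w x / w x₀) ^ (p - 1)) →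
      θ * w x₀ ^ 2 ≤ ρ ^ 2 * ((ρ ^ n)⁻¹ *
        ∫ x in Metric.closedBall x₀ (2 * ρ), ‖fderiv ℝ w x‖ ^ 2) := by
  obtain ⟨κ, hκ, hκ8, H⟩ := local_energy_lower_bound (n := n) ha hp hM hA
  refine ⟨κ, hκ, hκ8, fun q hq hqκ => ?_⟩
  obtain ⟨θ, hθ, H⟩ := H q hq hqκ
  refine ⟨θ, hθ, fun w x₀ ρ hw hx₀ hρ hρκ hk hM hP => ?_⟩
  have hx : 0 < ‖x₀‖ := norm_pos_iff.2 hx₀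
  have h8 : ρ ≤ 1 / 8 * ‖x₀‖ := hρκ.trans (by gcongr)
  obtain ⟨g, hg, hgw⟩ := exists_contDiff_eq_on_ball hw (x₀ := x₀) (r := 3 * ρ) (s := 4 * ρ)
    (by linarith) (by linarith) (by linarith)
  have heq (x : 𝔼 n) (hx : ‖x - x₀‖ ≤ 2 * ρ) : g x = w x := (hgw x (by linarith)).eq_of_nhds
  have h0 : g x₀ = w x₀ := heq x₀ (by simp; linarith)
  have := H g x₀ ρ hg hx₀ hρ hρκ (by rwa [h0])
    (fun x hx => by rw [heq x hx, h0]; exact hM x hx)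
    (fun x hx => by
      change _ ≤ wop a g x ∧ wop a g x ≤ _
      rw [heq x hx, h0, wop_congr (hgw x (by linarith))]; exact hP x hx)
  rw [h0, setIntegral_comp_affine (fun x => ‖fderiv ℝ g x‖ ^ 2) x₀ hρ 2] at this
  refine this.trans (le_of_eq ?_)
  congr 2
  refine setIntegral_congr_fun measurableSet_closedBall fun x hx => ?_
  rw [(hgw x (by have := mem_closedBall_iff_norm.1 hx; linarith)).fderiv_eq]

theorem rpow_le_two_rpow_abs_mul {X Y : ℝ} (hX : 0 < X) (hY : 0 < Y) (h1 : X ≤ 2 * Y)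
    (h2 : Y ≤ 2 * X) (e : ℝ) : X ^ e ≤ 2 ^ |e| * Y ^ e := by
  rcases le_total 0 e with he | he
  · rw [abs_of_nonneg he, ← mul_rpow (by norm_num) hY.le]
    gcongr
  · rw [abs_of_nonpos he]
    calc X ^ e ≤ (Y / 2) ^ e := rpow_le_rpow_of_nonpos (by positivity) (by linarith) he
      _ = _ := by
        rw [div_rpow hY.le (by norm_num), rpow_neg (by norm_num)]; field_simp

theorem point_selection {n : ℕ} {F : (𝔼 n) → ℝ} {z : 𝔼 n} {r : ℝ} (hr : 0 < r)
    (hF : ContinuousOn F (Metric.closedBall z r)) (hpos : ∀ x, ‖x - z‖ ≤ r → 0 < F x) :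
    ∃ (x₀ : 𝔼 n) (σ : ℝ), 0 < σ ∧ ‖x₀ - z‖ + 2 * σ = r ∧ r * F z ≤ 2 * σ * F x₀ ∧
      ∀ x, ‖x - x₀‖ ≤ σ → ‖x - z‖ ≤ r ∧ F x ≤ 2 * F x₀ := by
  obtain ⟨x₀, hx₀, hmax⟩ := (isCompact_closedBall z r).exists_isMaxOn
    (f := fun x => (r - ‖x - z‖) * F x) (Metric.nonempty_closedBall.2 hr.le)
    ((by fun_prop : Continuous fun x => r - ‖x - z‖).continuousOn.mul hF)
  have hx₀' : ‖x₀ - z‖ ≤ r := mem_closedBall_iff_norm.1 hx₀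
  have hmax' (x : 𝔼 n) (hx : ‖x - z‖ ≤ r) : (r - ‖x - z‖) * F x ≤ (r - ‖x₀ - z‖) * F x₀ :=
    hmax (mem_closedBall_iff_norm.2 hx)
  have hz := hmax' z (by simp [hr.le])
  rw [sub_self, norm_zero, sub_zero] at hz
  have hFz := hpos z (by simp [hr.le])
  have hFx := hpos x₀ hx₀'
  have hσ : 0 < r - ‖x₀ - z‖ := by
    by_contra h
    nlinarith [mul_pos hr hFz]
  refine ⟨x₀, (r - ‖x₀ - z‖) / 2, by linarith, by ring, by linarith, fun x hx => ?_⟩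
  have htri : ‖x - z‖ ≤ ‖x - x₀‖ + ‖x₀ - z‖ := norm_sub_le_norm_sub_add_norm_sub _ _ _
  have hxr : ‖x - z‖ ≤ r := by linarith
  refine ⟨hxr, ?_⟩
  have h1 := hmax' x hxr
  have h2 : (r - ‖x₀ - z‖) / 2 * F x ≤ (r - ‖x - z‖) * F x :=
    mul_le_mul_of_nonneg_right (by linarith) (hpos x hxr).le
  have h3 : (r - ‖x₀ - z‖) / 2 * F x ≤ (r - ‖x₀ - z‖) / 2 * (2 * F x₀) := by linarith
  exact le_of_mul_le_mul_left h3 (by linarith)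

/-- The critical scaling relation between height, radius and energy. -/
theorem rpow_le_sq_mul_rpow {N a p lam q k ρ X : ℝ} (hp : 2 < p) (hlam : 2 * lam = N - 2 - 2 * a)
    (hpn : (p - 2) * (N - 2) ≤ 4) (hk : 0 < k) (hρ : 0 < ρ) (hρX : ρ ≤ X)
    (hρq : ρ ^ 2 * X ^ (lam * (p - 2) - 2) * k ^ (p - 2) = q) :
    q ^ (2 / (p - 2)) * X ^ (2 * a) ≤ k ^ 2 * ρ ^ (N - 2) := by
  have hX : 0 < X := hρ.trans_le hρX
  have hp2 : 0 < p - 2 := by linarith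
  have hexp : N - 2 - 4 / (p - 2) ≤ 0 := by
    rw [sub_nonpos, le_div_iff₀ hp2]; linarith
  have e1 : q ^ (2 / (p - 2)) = ρ ^ (4 / (p - 2)) * X ^ (2 * lam - 4 / (p - 2)) * k ^ 2 := by
    rw [← hρq, mul_rpow (by positivity) (by positivity), mul_rpow (by positivity) (by positivity),
      ← rpow_natCast, ← rpow_mul hρ.le, ← rpow_mul hX.le, ← rpow_mul hk.le, ← rpow_natCast]
    congr 2
    · congr 1; push_cast; field_simp; norm_num
    · congr 1; field_simp; ring
    · push_cast; field_simp
  have e2 : X ^ (2 * lam - 4 / (p - 2)) * X ^ (2 * a) = X ^ (N - 2 - 4 / (p - 2)) := by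
    rw [← rpow_add hX, hlam]; ring_nf
  have e3 : X ^ (N - 2 - 4 / (p - 2)) ≤ ρ ^ (N - 2 - 4 / (p - 2)) :=
    rpow_le_rpow_of_nonpos hρ hρX hexp
  have e4 : ρ ^ (4 / (p - 2)) * ρ ^ (N - 2 - 4 / (p - 2)) = ρ ^ (N - 2) := by
    rw [← rpow_add hρ]; ring_nf
  calc q ^ (2 / (p - 2)) * X ^ (2 * a)
      = ρ ^ (4 / (p - 2)) * k ^ 2 * (X ^ (2 * lam - 4 / (p - 2)) * X ^ (2 * a)) := by rw [e1]; ring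
    _ ≤ ρ ^ (4 / (p - 2)) * k ^ 2 * ρ ^ (N - 2 - 4 / (p - 2)) := by rw [e2]; gcongr
    _ = k ^ 2 * (ρ ^ (4 / (p - 2)) * ρ ^ (N - 2 - 4 / (p - 2))) := by ring
    _ = _ := by rw [e4]

theorem setIntegral_sq_norm_fderiv_le {n : ℕ} {a : ℝ} (ha : 0 ≤ a) {w G : (𝔼 n) → ℝ}
    (hG : Integrable G) (hG0 : ∀ x, 0 ≤ G x)
    (hwG : ∀ x, x ≠ 0 → ‖x‖ ^ (-(2 * a)) * ‖fderiv ℝ w x‖ ^ 2 ≤ G x) {X : ℝ} (hX : 0 ≤ X)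
    {s t : Set (𝔼 n)} (hs : MeasurableSet s) (hst : s ⊆ t) (hsX : ∀ x ∈ s, x ≠ 0 ∧ ‖x‖ ≤ X) :
    ∫ x in s, ‖fderiv ℝ w x‖ ^ 2 ≤ X ^ (2 * a) * ∫ x in t, G x := by
  rw [← integral_const_mul]
  have hGX : ∀ x ∈ s, ‖fderiv ℝ w x‖ ^ 2 ≤ X ^ (2 * a) * G x := fun x hx => by
    obtain ⟨hx0, hxX⟩ := hsX x hx
    have h0 : 0 < ‖x‖ := norm_pos_iff.2 hx0
    have h1 : ‖x‖ ^ (2 * a) * ‖x‖ ^ (-(2 * a)) = 1 := by rw [← rpow_add h0]; simp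
    calc ‖fderiv ℝ w x‖ ^ 2 = ‖x‖ ^ (2 * a) * (‖x‖ ^ (-(2 * a)) * ‖fderiv ℝ w x‖ ^ 2) := by
          rw [← mul_assoc, h1, one_mul]
      _ ≤ X ^ (2 * a) * G x := by
          gcongr
          exact hwG x hx0
  refine (integral_mono_of_nonneg (Eventually.of_forall fun x => by positivity)
    (hG.const_mul _).integrableOn ((ae_restrict_iff' hs).2 (Eventually.of_forall hGX))).trans ?_
  refine setIntegral_mono_set (hG.const_mul _).integrableOn
    (Eventually.of_forall fun x => mul_nonneg (by positivity) (hG0 x)) hst.eventuallyLE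

set_option maxHeartbeats 2000000 in
theorem rpow_le_of_small_energy {n : ℕ} {a p lam A : ℝ} (ha : 0 ≤ a) (hp : 2 < p)
    (hlam : 2 * lam = (n : ℝ) - 2 - 2 * a) (hpn : (p - 2) * ((n : ℝ) - 2) ≤ 4) (hA : 1 ≤ A)
    {w G : (𝔼 n) → ℝ} (hw : ContDiffOn ℝ 2 w {0}ᶜ) (hpos : ∀ x, x ≠ 0 → 0 < w x)
    (hP : ∀ x, x ≠ 0 →
      ‖x‖ ^ (lam * (p - 2) - 2) / A * w x ^ (p - 1) ≤ wop a w x ∧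
      wop a w x ≤ A * ‖x‖ ^ (lam * (p - 2) - 2) * w x ^ (p - 1))
    (hG : Integrable G) (hG0 : ∀ x, 0 ≤ G x)
    (hwG : ∀ x, x ≠ 0 → ‖x‖ ^ (-(2 * a)) * ‖fderiv ℝ w x‖ ^ 2 ≤ G x) :
    ∃ C κ : ℝ, 0 < C ∧ 0 < κ ∧ ∀ q, 0 < q → q ≤ κ → ∃ ε : ℝ, 0 < ε ∧ ∀ z : 𝔼 n, z ≠ 0 →
      ∫ x in Metric.closedBall z (‖z‖ / 2), G x < ε →
      (‖z‖ ^ lam * w z) ^ ((p - 2) / 2) ≤ C * q ^ (1 / 2 : ℝ) := by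
  have hp2 : 0 < p - 2 := by linarith
  set γ := (p - 2) / 2 with hγ
  have hγ0 : 0 < γ := by rw [hγ]; linarith
  set e := lam * (p - 2) - 2 with he
  set M : ℝ := 2 ^ (1 / γ) with hM
  have hM1 : 1 ≤ M := one_le_rpow (by norm_num) (by positivity)
  have hT : 1 ≤ (2:ℝ) ^ |e| := one_le_rpow (by norm_num) (abs_nonneg _)
  set T := (2:ℝ) ^ |e| with hTd
  have hA0 : 0 < A := by linarith
  have hA' : 1 ≤ A * T := one_le_mul_of_one_le_of_one_le hA hT
  obtain ⟨κ, hκ, hκ8, H⟩ := punctured_local_energy_lower_bound (n := n) ha hp hM1 hA'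
  refine ⟨4 / κ * 2 ^ |-(e / 2)|, κ, by positivity, hκ, fun q hq hqκ => ?_⟩
  obtain ⟨θ, hθ, H⟩ := H q hq hqκ
  refine ⟨θ * q ^ (2 / (p - 2)) / 2 ^ (2 * a), by positivity, fun z hz hE => ?_⟩
  have hz0 : 0 < ‖z‖ := norm_pos_iff.2 hz
  have hball (x : 𝔼 n) (hx : ‖x - z‖ ≤ ‖z‖ / 2) : ‖z‖ / 2 ≤ ‖x‖ ∧ ‖x‖ ≤ 3 / 2 * ‖z‖ := by
    have h1 := norm_sub_norm_le z x
    rw [norm_sub_rev] at h1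
    have h2 := norm_sub_norm_le x z
    exact ⟨by linarith, by linarith⟩
  have hne (x : 𝔼 n) (hx : ‖x - z‖ ≤ ‖z‖ / 2) : x ≠ 0 :=
    norm_pos_iff.1 (by linarith [(hball x hx).1])
  obtain ⟨x₀, σ, hσ, hσr, hzx, hx⟩ := point_selection (F := fun x => w x ^ γ) (z := z)
    (r := ‖z‖ / 2) (by linarith)
    ((hw.continuousOn.mono fun x hx => hne x (mem_closedBall_iff_norm.1 hx)).rpow_const
      fun x _ => Or.inr hγ0.le) fun x hx => rpow_pos_of_pos (hpos x (hne x hx)) _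
  have hx₀z : ‖x₀ - z‖ ≤ ‖z‖ / 2 := by linarith
  have hx₀ := hne x₀ hx₀z
  have hX0 : 0 < ‖x₀‖ := norm_pos_iff.2 hx₀
  obtain ⟨hb1, hb2⟩ := hball x₀ hx₀z
  have hσX : σ ≤ ‖x₀‖ / 2 := by linarith [norm_nonneg (x₀ - z)]
  set k := w x₀ with hk
  have hk0 : 0 < k := hpos x₀ hx₀
  set X := ‖x₀‖ with hX
  set ρ := √(q * X ^ (-e) * k ^ (-(p - 2))) with hρ
  have hρ0 : 0 < ρ := by rw [hρ]; positivity
  have hρ2 : ρ ^ 2 = q * X ^ (-e) * k ^ (-(p - 2)) := Real.sq_sqrt (by positivity)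
  have hXe : X ^ (-e) * X ^ e = 1 := by rw [← rpow_add hX0]; simp
  have hke : k ^ (-(p - 2)) * k ^ (p - 2) = 1 := by rw [← rpow_add hk0]; simp
  have hρq : ρ ^ 2 * X ^ e * k ^ (p - 2) = q := by
    calc _ = q * (X ^ (-e) * X ^ e) * (k ^ (-(p - 2)) * k ^ (p - 2)) := by rw [hρ2]; ring
      _ = q := by rw [hXe, hke]; ring
  rcases le_or_gt ρ (κ * σ) with hcase | hcase
  · exfalso
    have hρσ : 2 * ρ ≤ σ := by nlinarith
    have hbound (x : 𝔼 n) (hxρ : ‖x - x₀‖ ≤ 2 * ρ) : 0 < w x ∧ w x ≤ M * k ∧ x ≠ 0 := by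
      obtain ⟨h1, h2⟩ := hx x (by linarith)
      have hw0 := hpos x (hne x h1)
      refine ⟨hw0, ?_, hne x h1⟩
      refine (rpow_le_rpow_iff hw0.le (by positivity) hγ0).1 ?_
      rw [mul_rpow (by positivity) hk0.le, hM, ← rpow_mul (by norm_num), one_div_mul_cancel hγ0.ne',
        rpow_one]
      exact h2
    have hqk : q * k / ρ ^ 2 = X ^ e * k ^ (p - 1) := by
      rw [← hρq, show p - 1 = p - 2 + 1 by ring, rpow_add_one hk0.ne']
      field_simp
    have key := H w x₀ ρ hw hx₀ hρ0 (by nlinarith) hk0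
      (fun x hx => ⟨(hbound x hx).1.le, (hbound x hx).2.1⟩) (fun x hxρ => by
        obtain ⟨h1, -, h3⟩ := hbound x hxρ
        have hx0 : 0 < ‖x‖ := norm_pos_iff.2 h3
        obtain ⟨l, u⟩ := hP x h3
        have t1 := norm_sub_norm_le x x₀
        have t2 := norm_sub_norm_le x₀ x
        rw [norm_sub_rev] at t2
        have r1 := rpow_le_two_rpow_abs_mul hx0 hX0 (by linarith) (by linarith) e
        have r2 := rpow_le_two_rpow_abs_mul hX0 hx0 (by linarith) (by linarith) e
        have hkp : k ^ (p - 1) * (w x / k) ^ (p - 1) = w x ^ (p - 1) := by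
          rw [← mul_rpow hk0.le (by positivity), mul_div_cancel₀ _ hk0.ne']
        rw [hqk]
        constructor
        · calc X ^ e * k ^ (p - 1) / (A * T) * (w x / k) ^ (p - 1)
              = X ^ e / (A * T) * (k ^ (p - 1) * (w x / k) ^ (p - 1)) := by ring
            _ ≤ (T * ‖x‖ ^ e) / (A * T) * w x ^ (p - 1) := by rw [hkp]; gcongr
            _ = ‖x‖ ^ e / A * w x ^ (p - 1) := by field_simp
            _ ≤ _ := l
        · calc wop a w x ≤ A * ‖x‖ ^ e * w x ^ (p - 1) := u
            _ ≤ A * (T * X ^ e) * (k ^ (p - 1) * (w x / k) ^ (p - 1)) := by rw [hkp]; gcongr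
            _ = _ := by ring)
    have hcut := setIntegral_sq_norm_fderiv_le ha hG hG0 hwG (X := 2 * X) (by positivity)
      (s := Metric.closedBall x₀ (2 * ρ)) (t := Metric.closedBall z (‖z‖ / 2))
      measurableSet_closedBall
      (fun x h => mem_closedBall_iff_norm.2 (hx x ((mem_closedBall_iff_norm.1 h).trans hρσ)).1)
      (fun x h => by
        have h' := mem_closedBall_iff_norm.1 h
        exact ⟨(hbound x h').2.2, by have := norm_sub_norm_le x x₀; linarith⟩)
    set E := ∫ x in Metric.closedBall z (‖z‖ / 2), G x
    have sc := rpow_le_sq_mul_rpow hp hlam hpn hk0 hρ0 (by nlinarith) hρq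
    have hρn : ρ ^ ((n : ℝ) - 2) * (ρ ^ 2 * (ρ ^ n)⁻¹) = 1 := by
      rw [rpow_sub hρ0, rpow_natCast, rpow_two]; field_simp
    have c1 : θ * (q ^ (2 / (p - 2)) * X ^ (2 * a)) ≤ 2 ^ (2 * a) * X ^ (2 * a) * E := by
      calc θ * (q ^ (2 / (p - 2)) * X ^ (2 * a)) ≤ θ * (k ^ 2 * ρ ^ ((n : ℝ) - 2)) := by gcongr
        _ = (θ * k ^ 2) * ρ ^ ((n : ℝ) - 2) := by ring
        _ ≤ (ρ ^ 2 * ((ρ ^ n)⁻¹ * ((2 * X) ^ (2 * a) * E))) * ρ ^ ((n : ℝ) - 2) := by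
          refine mul_le_mul_of_nonneg_right (key.trans ?_) (by positivity)
          gcongr
        _ = (ρ ^ ((n : ℝ) - 2) * (ρ ^ 2 * (ρ ^ n)⁻¹)) * ((2 * X) ^ (2 * a) * E) := by ring
        _ = _ := by rw [hρn, mul_rpow (by norm_num) hX0.le]; ring
    have c2 : θ * q ^ (2 / (p - 2)) ≤ 2 ^ (2 * a) * E := by
      refine le_of_mul_le_mul_right ?_ (rpow_pos_of_pos hX0 (2 * a))
      linarith
    rw [lt_div_iff₀ (by positivity)] at hE
    linarith
  · have h1 : ρ * k ^ γ = q ^ (1 / 2 : ℝ) * X ^ (-(e / 2)) := by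
      have : (ρ * k ^ γ) ^ 2 = (q ^ (1 / 2 : ℝ) * X ^ (-(e / 2))) ^ 2 := by
        have k2 : (k ^ γ) ^ 2 = k ^ (p - 2) := by
          rw [← rpow_natCast, ← rpow_mul hk0.le]; congr 1; rw [hγ]; push_cast; ring
        have q2 : (q ^ (1 / 2 : ℝ)) ^ 2 = q := by
          rw [← rpow_natCast, ← rpow_mul hq.le]; norm_num
        have x2 : (X ^ (-(e / 2))) ^ 2 = X ^ (-e) := by
          rw [← rpow_natCast, ← rpow_mul hX0.le]; congr 1; push_cast; ring
        rw [mul_pow, mul_pow, k2, q2, x2, hρ2]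
        calc _ = q * X ^ (-e) * (k ^ (-(p - 2)) * k ^ (p - 2)) := by ring
          _ = _ := by rw [hke, mul_one]
      exact (pow_left_inj₀ (by positivity) (by positivity) two_ne_zero).1 this
    have h2 := rpow_le_two_rpow_abs_mul hX0 hz0 (by linarith) (by linarith) (-(e / 2))
    have h3 : ‖z‖ / 2 * w z ^ γ ≤ 2 / κ * (q ^ (1 / 2 : ℝ) * (2 ^ |-(e / 2)| * ‖z‖ ^ (-(e / 2)))) := by
      calc ‖z‖ / 2 * w z ^ γ ≤ 2 * σ * k ^ γ := hzx
        _ ≤ 2 * (ρ / κ) * k ^ γ := by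
          gcongr
          rw [le_div_iff₀ hκ]; linarith
        _ = 2 / κ * (ρ * k ^ γ) := by ring
        _ ≤ _ := by rw [h1]; gcongr
    have hwz := hpos z hz
    have h4 : (‖z‖ ^ lam * w z) ^ γ = 2 * ‖z‖ ^ (e / 2) * (‖z‖ / 2 * w z ^ γ) := by
      rw [mul_rpow (by positivity) hwz.le, ← rpow_mul hz0.le]
      have : lam * γ = e / 2 + 1 := by rw [hγ, he]; ring
      rw [this, rpow_add_one hz0.ne']; ring
    have hze : ‖z‖ ^ (e / 2) * ‖z‖ ^ (-(e / 2)) = 1 := by rw [← rpow_add hz0]; simp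
    rw [h4]
    calc _ ≤ 2 * ‖z‖ ^ (e / 2) * (2 / κ * (q ^ (1 / 2 : ℝ) * (2 ^ |-(e / 2)| * ‖z‖ ^ (-(e / 2))))) := by
          gcongr
      _ = 4 / κ * 2 ^ |-(e / 2)| * q ^ (1 / 2 : ℝ) * (‖z‖ ^ (e / 2) * ‖z‖ ^ (-(e / 2))) := by ring
      _ = _ := by rw [hze, mul_one]

theorem exists_setIntegral_closedBall_lt {n : ℕ} (hn : n ≠ 0) {G : (𝔼 n) → ℝ} (hG : Integrable G)
    (hG0 : ∀ x, 0 ≤ G x) {ε : ℝ} (hε : 0 < ε) : ∃ r R : ℝ, 0 < r ∧ 0 < R ∧ ∀ z : 𝔼 n,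
      ‖z‖ < r ∨ R < ‖z‖ → ∫ x in Metric.closedBall z (‖z‖ / 2), G x < ε := by
  have hvol : Tendsto (volume ∘ fun z : 𝔼 n => Metric.closedBall z (‖z‖ / 2)) (𝓝 0) (𝓝 0) := by
    have e : (volume ∘ fun z : 𝔼 n => Metric.closedBall z (‖z‖ / 2)) = fun z =>
        ENNReal.ofReal ((‖z‖ / 2) ^ n) * volume (Metric.ball (0 : 𝔼 n) 1) := by
      funext z
      have := Measure.addHaar_closedBall (volume : Measure (𝔼 n)) z (r := ‖z‖ / 2) (by positivity)
      rw [finrank_euclideanSpace_fin] at this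
      exact this
    rw [e]
    have h1 : Tendsto (fun z : 𝔼 n => ENNReal.ofReal ((‖z‖ / 2) ^ n)) (𝓝 0) (𝓝 0) := by
      have : Continuous fun z : 𝔼 n => ENNReal.ofReal ((‖z‖ / 2) ^ n) :=
        ENNReal.continuous_ofReal.comp (by fun_prop)
      simpa [hn] using this.tendsto 0
    simpa using ENNReal.Tendsto.mul_const h1 (Or.inr measure_ball_lt_top.ne)
  have h0 := hG.tendsto_setIntegral_nhds_zero hvol
  obtain ⟨r, hr, hr'⟩ := Metric.eventually_nhds_iff.1 (h0.eventually_lt_const hε)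
  have hcov : AECover (volume : Measure (𝔼 n)) atTop fun R : ℝ => Metric.ball (0 : 𝔼 n) R :=
    aecover_ball tendsto_id
  have h2 := hcov.integral_tendsto_of_countably_generated hG
  obtain ⟨R, hR, hR0⟩ := ((h2.eventually_const_lt (sub_lt_self _ hε)).and
    (eventually_gt_atTop 0)).exists
  refine ⟨r, 2 * R, hr, by linarith, fun z hz => ?_⟩
  rcases hz with hz | hz
  · exact hr' (by simpa using hz)
  · have hsub : Metric.closedBall z (‖z‖ / 2) ⊆ (Metric.ball (0 : 𝔼 n) R)ᶜ := fun x hx => by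
      have h1 := mem_closedBall_iff_norm.1 hx
      have h2 := norm_sub_norm_le z x
      rw [norm_sub_rev] at h2
      simp only [Set.mem_compl_iff, mem_ball_zero_iff, not_lt]
      linarith
    have h3 := setIntegral_mono_set (hG.integrableOn (s := (Metric.ball (0 : 𝔼 n) R)ᶜ))
      (Eventually.of_forall hG0) hsub.eventuallyLE
    have h4 := integral_add_compl (measurableSet_ball (x := (0 : 𝔼 n)) (ε := R)) hG
    linarith

/-- Scale-invariant smallness of a finite-energy solution near the origin and near infinity. -/
theorem exists_norm_rpow_mul_le {n : ℕ} (hn : n ≠ 0) {a p lam A : ℝ} (ha : 0 ≤ a) (hp : 2 < p)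
    (hlam : 2 * lam = (n : ℝ) - 2 - 2 * a) (hpn : (p - 2) * ((n : ℝ) - 2) ≤ 4) (hA : 1 ≤ A)
    {w G : (𝔼 n) → ℝ} (hw : ContDiffOn ℝ 2 w {0}ᶜ) (hpos : ∀ x, x ≠ 0 → 0 < w x)
    (hP : ∀ x, x ≠ 0 →
      ‖x‖ ^ (lam * (p - 2) - 2) / A * w x ^ (p - 1) ≤ wop a w x ∧
      wop a w x ≤ A * ‖x‖ ^ (lam * (p - 2) - 2) * w x ^ (p - 1))
    (hG : Integrable G) (hG0 : ∀ x, 0 ≤ G x)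
    (hwG : ∀ x, x ≠ 0 → ‖x‖ ^ (-(2 * a)) * ‖fderiv ℝ w x‖ ^ 2 ≤ G x) {δ : ℝ} (hδ : 0 < δ) :
    ∃ r R : ℝ, 0 < r ∧ 0 < R ∧ ∀ z : 𝔼 n, z ≠ 0 → ‖z‖ < r ∨ R < ‖z‖ → ‖z‖ ^ lam * w z ≤ δ := by
  obtain ⟨C, κ, hC, hκ, H⟩ := rpow_le_of_small_energy ha hp hlam hpn hA hw hpos hP hG hG0 hwG
  have hγ : 0 < (p - 2) / 2 := by linarith
  set q := min κ ((δ ^ ((p - 2) / 2) / C) ^ 2) with hq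
  have hq0 : 0 < q := by rw [hq]; positivity
  obtain ⟨ε, hε, H⟩ := H q hq0 (min_le_left _ _)
  obtain ⟨r, R, hr, hR, hrR⟩ := exists_setIntegral_closedBall_lt hn hG hG0 hε
  refine ⟨r, R, hr, hR, fun z hz hzr => ?_⟩
  have h1 := H z hz (hrR z hzr)
  have h2 : q ^ (1 / 2 : ℝ) ≤ δ ^ ((p - 2) / 2) / C := by
    rw [← Real.sqrt_eq_rpow]
    exact Real.sqrt_le_iff.2 ⟨by positivity, min_le_right _ _⟩
  refine (rpow_le_rpow_iff (mul_nonneg (by positivity) (hpos z hz).le) hδ.le hγ).1 (h1.trans ?_)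
  calc C * q ^ (1 / 2 : ℝ) ≤ C * (δ ^ ((p - 2) / 2) / C) := by gcongr
    _ = _ := by field_simp

theorem hasDerivAt_add_smul {n : ℕ} (x e : 𝔼 n) (t : ℝ) :
    HasDerivAt (fun t : ℝ => x + t • e) e t := by
  simpa using ((hasDerivAt_id t).smul_const e).const_add x

theorem fderiv_fderiv_apply_nonpos_of_isLocalMax {n : ℕ} {f : (𝔼 n) → ℝ} {x : 𝔼 n}
    (hf : ContDiffAt ℝ 2 f x) (hmax : IsLocalMax f x) (e : 𝔼 n) :
    fderiv ℝ (fun y => fderiv ℝ f y e) x e ≤ 0 := by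
  by_contra! hpos
  have hcont : ContinuousAt (fun t : ℝ => x + t • e) 0 := (hasDerivAt_add_smul x e 0).continuousAt
  have ht : Tendsto (fun t : ℝ => x + t • e) (𝓝 0) (𝓝 x) := by simpa using hcont.tendsto
  have hd : deriv (fun t : ℝ => f (x + t • e)) =ᶠ[𝓝 0] fun t => fderiv ℝ f (x + t • e) e := by
    filter_upwards [ht.eventually hf.eventually_differentiableAt] with t h
    exact (h.hasFDerivAt.comp_hasDerivAt t (hasDerivAt_add_smul x e t)).deriv
  have hdd : deriv (deriv fun t : ℝ => f (x + t • e)) 0 = fderiv ℝ (fun y => fderiv ℝ f y e) x e := by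
    rw [hd.deriv_eq]
    have h := (differentiableAt_fderiv_apply hf e).hasFDerivAt
    rw [show x = x + (0 : ℝ) • e by simp] at h
    have h' := (h.comp_hasDerivAt (0 : ℝ) (hasDerivAt_add_smul x e 0)).deriv
    rw [zero_smul, add_zero] at h'
    exact h'
  have hmax' : IsLocalMax (fun t : ℝ => f (x + t • e)) 0 := by
    have := ht.eventually hmax
    simpa [IsLocalMax, IsMaxFilter] using this
  have hmin : IsLocalMin (fun t : ℝ => f (x + t • e)) 0 := by
    refine isLocalMin_of_deriv_deriv_pos (by rw [hdd]; exact hpos) hmax'.deriv_eq_zero ?_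
    exact ContinuousAt.comp (g := f) (by simpa using hf.continuousAt) hcont
  have hconst : (fun t : ℝ => f (x + t • e)) =ᶠ[𝓝 0] fun _ => f (x + (0 : ℝ) • e) := by
    filter_upwards [hmax', hmin] with t h1 h2
    exact le_antisymm h1 h2
  have : deriv (deriv fun t : ℝ => f (x + t • e)) 0 = 0 := by
    rw [hconst.deriv.deriv_eq]; simp
  linarith

theorem wop_nonneg_of_isLocalMax {n : ℕ} {a : ℝ} {f : (𝔼 n) → ℝ} {x : 𝔼 n}
    (hf : ContDiffAt ℝ 2 f x) (hmax : IsLocalMax f x) : 0 ≤ wop a f x := by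
  unfold wop lapl
  rw [hmax.fderiv_eq_zero]
  have := Finset.sum_nonpos fun i (_ : i ∈ Finset.univ) =>
    fderiv_fderiv_apply_nonpos_of_isLocalMax hf hmax (EuclideanSpace.single i (1 : ℝ))
  simpa using this

theorem le_of_wop_lt {n : ℕ} {a r₀ r₁ : ℝ} {w H : (𝔼 n) → ℝ} (hw : ContDiffOn ℝ 2 w {0}ᶜ)
    (hH : ContDiffOn ℝ 2 H {0}ᶜ) (hHpos : ∀ x, x ≠ 0 → ‖x‖ ≤ r₀ → 0 < H x)
    (hb : ∀ x, x ≠ 0 → ‖x‖ = r₀ → w x ≤ H x) (hr₁ : 0 < r₁)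
    (h0 : ∀ x, x ≠ 0 → ‖x‖ ≤ r₁ → w x ≤ H x)
    (hlt : ∀ x, x ≠ 0 → ‖x‖ < r₀ → ∀ M, 1 < M → w x = M * H x → wop a w x < M * wop a H x)
    {x : 𝔼 n} (hx : x ≠ 0) (hxr : ‖x‖ ≤ r₀) : w x ≤ H x := by
  by_contra! hxH
  set S : Set (𝔼 n) := Metric.closedBall 0 r₀ ∩ {y | r₁ ≤ ‖y‖} with hS
  have hSc : IsCompact S := (isCompact_closedBall _ _).inter_right
    (isClosed_le continuous_const continuous_norm)
  have hS0 (y) (hy : y ∈ S) : y ≠ 0 := norm_pos_iff.1 (hr₁.trans_le hy.2)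
  have hSr (y) (hy : y ∈ S) : ‖y‖ ≤ r₀ := by simpa using hy.1
  have hxr₁ : r₁ < ‖x‖ := by
    by_contra! h
    exact (h0 x hx h).not_gt hxH
  have hxS : x ∈ S := ⟨by simpa using hxr, hxr₁.le⟩
  have hc : ContinuousOn (fun y => w y / H y) S :=
    (hw.continuousOn.mono fun y hy => hS0 y hy).div (hH.continuousOn.mono fun y hy => hS0 y hy)
      fun y hy => (hHpos y (hS0 y hy) (hSr y hy)).ne'
  obtain ⟨m, hmS, hm⟩ := hSc.exists_isMaxOn ⟨x, hxS⟩ hc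
  have hm0 := hS0 m hmS
  have hHm := hHpos m hm0 (hSr m hmS)
  set M := w m / H m with hM
  have hM1 : 1 < M := by
    have h1 : w x / H x ≤ M := hm hxS
    have h2 : 1 < w x / H x := by rwa [one_lt_div (hHpos x hx hxr)]
    linarith
  have hmw : w m = M * H m := by rw [hM]; field_simp
  have hwm : H m < w m := by rw [hmw]; nlinarith
  have hmr₀ : ‖m‖ < r₀ := lt_of_le_of_ne (hSr m hmS) fun h => (hb m hm0 h).not_gt hwm
  have hmr₁ : r₁ < ‖m‖ := by
    by_contra! h
    exact (h0 m hm0 h).not_gt hwm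
  have hloc : IsLocalMax (fun y => w y + (-M) * H y) m := by
    have h1 : ∀ᶠ y in 𝓝 m, ‖y‖ < r₀ := continuous_norm.continuousAt.eventually_lt_const hmr₀
    have h2 : ∀ᶠ y in 𝓝 m, r₁ < ‖y‖ := continuous_norm.continuousAt.eventually_const_lt hmr₁
    filter_upwards [h1, h2] with y hy1 hy2
    have hyS : y ∈ S := ⟨by simpa using hy1.le, hy2.le⟩
    have h3 : w y / H y ≤ M := hm hyS
    rw [div_le_iff₀ (hHpos y (hS0 y hyS) hy1.le)] at h3
    rw [hmw]; linarith
  have nb : ({0}ᶜ : Set (𝔼 n)) ∈ 𝓝 m := isOpen_compl_singleton.mem_nhds hm0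
  have cw := hw.contDiffAt nb
  have cH := hH.contDiffAt nb
  have h4 := wop_nonneg_of_isLocalMax (a := a) (cw.add (contDiffAt_const.mul cH)) hloc
  rw [wop_add cw (contDiffAt_const.mul cH), wop_const_mul cH] at h4
  linarith [hlt m hm0 hmr₀ M hM1 hmw]

theorem contDiffOn_norm_rpow {n : ℕ} (s : ℝ) :
    ContDiffOn ℝ 2 (fun x : 𝔼 n => ‖x‖ ^ s) {0}ᶜ := fun _ hx =>
  ((contDiffAt_norm ℝ hx).rpow_const_of_ne (norm_ne_zero_iff.2 hx)).contDiffWithinAt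

theorem hasFDerivAt_norm_rpow_of_ne {n : ℕ} (s : ℝ) {x : 𝔼 n} (hx : x ≠ 0) :
    HasFDerivAt (fun x : 𝔼 n => ‖x‖ ^ s) ((s * ‖x‖ ^ (s - 2)) • innerSL ℝ x) x := by
  have h0 : 0 < ‖x‖ := norm_pos_iff.2 hx
  have h1 : HasFDerivAt (fun x : 𝔼 n => ‖x‖ ^ 2) (2 • innerSL ℝ x) x :=
    (hasStrictFDerivAt_norm_sq x).hasFDerivAt
  have h2 := h1.rpow_const (p := s / 2) (Or.inl (by positivity))
  have e (y : 𝔼 n) : (‖y‖ ^ 2) ^ (s / 2) = ‖y‖ ^ s := by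
    rw [← rpow_natCast, ← rpow_mul (norm_nonneg y)]; congr 1; push_cast; ring
  simp only [e] at h2
  refine h2.congr_fderiv ?_
  have e' : (‖x‖ ^ 2) ^ (s / 2 - 1) = ‖x‖ ^ (s - 2) := by
    rw [← rpow_natCast, ← rpow_mul h0.le]; congr 1; push_cast; ring
  rw [e']
  ext v
  simp
  ring

theorem wop_norm_rpow {n : ℕ} (a s : ℝ) {x : 𝔼 n} (hx : x ≠ 0) :
    wop a (fun y : 𝔼 n => ‖y‖ ^ s) x = -(s * (s + (n - 2 - 2 * a))) * ‖x‖ ^ (s - 2) := by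
  have h0 : 0 < ‖x‖ := norm_pos_iff.2 hx
  have hl : lapl (fun y : 𝔼 n => ‖y‖ ^ s) x = s * (s + n - 2) * ‖x‖ ^ (s - 2) := by
    unfold lapl
    have hi (i : Fin n) : fderiv ℝ (fun y => fderiv ℝ (fun y : 𝔼 n => ‖y‖ ^ s) y
        (EuclideanSpace.single i 1)) x (EuclideanSpace.single i 1) =
        s * ((s - 2) * ‖x‖ ^ (s - 2 - 2) * x i ^ 2 + ‖x‖ ^ (s - 2)) := by
      have h1 : (fun y => fderiv ℝ (fun y : 𝔼 n => ‖y‖ ^ s) y (EuclideanSpace.single i 1)) =ᶠ[𝓝 x]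
          fun y => s * (‖y‖ ^ (s - 2) * innerSL ℝ (EuclideanSpace.single i (1:ℝ)) y) := by
        filter_upwards [isOpen_compl_singleton.mem_nhds hx] with y hy
        rw [(hasFDerivAt_norm_rpow_of_ne s hy).fderiv]
        simp [EuclideanSpace.inner_single_left, EuclideanSpace.inner_single_right]; ring
      have h2 := ((hasFDerivAt_norm_rpow_of_ne (s - 2) hx).fun_mul
        (innerSL ℝ (EuclideanSpace.single i (1:ℝ))).hasFDerivAt).const_mul s
      rw [h1.fderiv_eq, HasFDerivAt.fderiv h2]
      simp [EuclideanSpace.inner_single_left, EuclideanSpace.inner_single_right]; ring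
    simp only [hi]
    rw [← Finset.mul_sum, Finset.sum_add_distrib, ← Finset.mul_sum]
    have h3 : ∑ i, x i ^ 2 = ‖x‖ ^ 2 := (EuclideanSpace.real_norm_sq_eq x).symm
    have h4 : ‖x‖ ^ (s - 2 - 2) * ‖x‖ ^ 2 = ‖x‖ ^ (s - 2) := by
      rw [← rpow_natCast, ← rpow_add h0]; norm_num
    rw [h3]
    simp only [Finset.sum_const, Finset.card_univ, Fintype.card_fin, nsmul_eq_mul]
    rw [mul_assoc (s - 2), h4]; ring
  unfold wop
  rw [hl, (hasFDerivAt_norm_rpow_of_ne s hx).fderiv]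
  have : ((s * ‖x‖ ^ (s - 2)) • innerSL ℝ x) x / ‖x‖ ^ 2 = s * ‖x‖ ^ (s - 2) := by
    simp; field_simp
  rw [this]; ring

/-- Smallness at the origin improves to growth slower than the fundamental singularity. -/
theorem exists_le_mul_norm_rpow_neg {n : ℕ} {a p lam A s : ℝ} (hp : 2 < p)
    (hlam : 2 * lam = (n : ℝ) - 2 - 2 * a) (hs : 0 < s) (hsl : s < lam)
    (hA : 1 ≤ A) {w : (𝔼 n) → ℝ} (hw : ContDiffOn ℝ 2 w {0}ᶜ) (hpos : ∀ x, x ≠ 0 → 0 < w x)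
    (hP : ∀ x, x ≠ 0 → wop a w x ≤ A * ‖x‖ ^ (lam * (p - 2) - 2) * w x ^ (p - 1))
    (hsmall : ∀ δ, 0 < δ → ∃ r : ℝ, 0 < r ∧ ∀ x : 𝔼 n, x ≠ 0 → ‖x‖ < r → ‖x‖ ^ lam * w x ≤ δ) :
    ∃ r K : ℝ, 0 < r ∧ 0 < K ∧ ∀ x : 𝔼 n, x ≠ 0 → ‖x‖ ≤ r → w x ≤ K * ‖x‖ ^ (-s) := by
  have hp2 : 0 < p - 2 := by linarith
  have hA0 : 0 < A := by linarith
  have hη : 0 < s * (2 * lam - s) := mul_pos hs (by linarith)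
  set δ := (s * (2 * lam - s) / 2 / A) ^ (1 / (p - 2)) with hδ
  have hδ0 : 0 < δ := by rw [hδ]; positivity
  have hAδ : A * δ ^ (p - 2) = s * (2 * lam - s) / 2 := by
    rw [hδ, ← rpow_mul (by positivity), one_div_mul_cancel hp2.ne', rpow_one]; field_simp
  obtain ⟨r, hr, hrδ⟩ := hsmall δ hδ0
  have hr2 : 0 < r / 2 := by linarith
  set K := δ * (r / 2) ^ (s - lam) with hK
  have hK0 : 0 < K := by rw [hK]; positivity
  refine ⟨r / 2, K, hr2, hK0, fun x hx hxr => ?_⟩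
  have hx0 : 0 < ‖x‖ := norm_pos_iff.2 hx
  have main : ∀ ε, 0 < ε → w x ≤ K * ‖x‖ ^ (-s) + ε * ‖x‖ ^ (-lam) := by
    intro ε hε
    obtain ⟨r₁, hr₁, hr₁ε⟩ := hsmall ε hε
    have cs := contDiffOn_norm_rpow (n := n) (-s)
    have cl := contDiffOn_norm_rpow (n := n) (-lam)
    refine le_of_wop_lt (a := a) (r₀ := r / 2) (r₁ := r₁ / 2)
      (H := fun x => K * ‖x‖ ^ (-s) + ε * ‖x‖ ^ (-lam)) hw
      ((contDiffOn_const.mul cs).add (contDiffOn_const.mul cl))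
      (fun y hy _ => ?_) (fun y hy hyr => ?_) (by linarith) (fun y hy hyr => ?_)
      (fun y hy hyr M hM hwM => ?_) hx hxr
    all_goals have hy0 : 0 < ‖y‖ := norm_pos_iff.2 hy
    · positivity
    · have h1 := hrδ y hy (by linarith)
      have h2 : K * ‖y‖ ^ (-s) = δ * ‖y‖ ^ (-lam) := by
        rw [hK, ← hyr, mul_assoc, ← rpow_add hy0]; ring_nf
      have h3 : w y ≤ δ * ‖y‖ ^ (-lam) := by
        rw [rpow_neg hy0.le, ← div_eq_mul_inv, le_div_iff₀ (by positivity)]; linarith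
      have : 0 ≤ ε * ‖y‖ ^ (-lam) := by positivity
      linarith
    · have h1 := hr₁ε y hy (by linarith)
      have h3 : w y ≤ ε * ‖y‖ ^ (-lam) := by
        rw [rpow_neg hy0.le, ← div_eq_mul_inv, le_div_iff₀ (by positivity)]; linarith
      have : 0 ≤ K * ‖y‖ ^ (-s) := by positivity
      linarith
    · have nb : ({0}ᶜ : Set (𝔼 n)) ∈ 𝓝 y := isOpen_compl_singleton.mem_nhds hy
      rw [wop_add (contDiffAt_const.mul (cs.contDiffAt nb))
        (contDiffAt_const.mul (cl.contDiffAt nb)), wop_const_mul (cs.contDiffAt nb),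
        wop_const_mul (cl.contDiffAt nb), wop_norm_rpow a _ hy, wop_norm_rpow a _ hy, ← hlam]
      have hwy := hpos y hy
      have h1 := hrδ y hy (by linarith)
      have h2 : wop a w y ≤ s * (2 * lam - s) / 2 * (‖y‖ ^ (-2 : ℝ) * w y) := by
        calc wop a w y ≤ A * ‖y‖ ^ (lam * (p - 2) - 2) * w y ^ (p - 1) := hP y hy
          _ = A * (‖y‖ ^ lam * w y) ^ (p - 2) * (‖y‖ ^ (-2 : ℝ) * w y) := by
            rw [mul_rpow (by positivity) hwy.le, ← rpow_mul hy0.le,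
              show p - 1 = p - 2 + 1 by ring, rpow_add_one hwy.ne', sub_eq_add_neg, rpow_add hy0]
            ring
          _ ≤ A * δ ^ (p - 2) * (‖y‖ ^ (-2 : ℝ) * w y) := by gcongr
          _ = _ := by rw [hAδ]
      have e1 : ‖y‖ ^ (-s - 2) = ‖y‖ ^ (-2 : ℝ) * ‖y‖ ^ (-s) := by rw [← rpow_add hy0]; ring_nf
      have e2 : ‖y‖ ^ (-lam - 2) = ‖y‖ ^ (-2 : ℝ) * ‖y‖ ^ (-lam) := by
        rw [← rpow_add hy0]; ring_nf
      refine h2.trans_lt ?_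
      rw [hwM, e1, e2]
      set P := ‖y‖ ^ (-2 : ℝ)
      set S := ‖y‖ ^ (-s)
      set L := ‖y‖ ^ (-lam)
      have hP0 : 0 < P := by positivity
      have hS0 : 0 < S := by positivity
      have hL0 : 0 < L := by positivity
      have e3 : M * (K * (-(-s * (-s + 2 * lam)) * (P * S)) +
          ε * (-(-lam * (-lam + 2 * lam)) * (P * L))) -
          s * (2 * lam - s) / 2 * (P * (M * (K * S + ε * L))) =
          M * P * (K * S * (s * (2 * lam - s) / 2) +
            ε * L * (s * (2 * lam - s) / 2 + (lam - s) ^ 2)) := by ring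
      rw [← sub_pos, e3]
      positivity
  refine le_of_forall_pos_le_add fun η hη => ?_
  have := main (η / ‖x‖ ^ (-lam)) (by positivity)
  rwa [div_mul_cancel₀ _ (by positivity)] at this

theorem exists_le_near_zero {n : ℕ} {a p lam A : ℝ} (hp : 2 < p) (hlam0 : 0 < lam)
    (hlam : 2 * lam = (n : ℝ) - 2 - 2 * a)
    (hA : 1 ≤ A) {w : (𝔼 n) → ℝ} (hw : ContDiffOn ℝ 2 w {0}ᶜ) (hpos : ∀ x, x ≠ 0 → 0 < w x)
    (hP : ∀ x, x ≠ 0 → wop a w x ≤ A * ‖x‖ ^ (lam * (p - 2) - 2) * w x ^ (p - 1))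
    (hsmall : ∀ δ, 0 < δ → ∃ r : ℝ, 0 < r ∧ ∀ x : 𝔼 n, x ≠ 0 → ‖x‖ < r → ‖x‖ ^ lam * w x ≤ δ) :
    ∃ r C : ℝ, 0 < r ∧ ∀ x : 𝔼 n, x ≠ 0 → ‖x‖ ≤ r → w x ≤ C := by
  have hp1 : 0 < p - 1 := by linarith
  have hp2 : 0 < p - 2 := by linarith
  have hA0 : 0 < A := by linarith
  set s := lam * (p - 2) / (2 * (p - 1)) with hs
  have hs0 : 0 < s := by rw [hs]; positivity
  have hsl : s < lam := by
    rw [hs, div_lt_iff₀ (by positivity)]; nlinarith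
  obtain ⟨r, K, hr, hK, hwK⟩ := exists_le_mul_norm_rpow_neg hp hlam hs0 hsl hA hw hpos hP hsmall
  set τ := lam * (p - 2) / 2 with hτ
  have hτ0 : 0 < τ := by rw [hτ]; positivity
  have hsτ : s * (p - 1) = τ := by rw [hs, hτ]; field_simp
  set B := A * K ^ (p - 1) / (τ * (τ + 2 * lam)) with hB
  have hB0 : 0 < B := by rw [hB]; positivity
  have hBe : B * (τ * (τ + 2 * lam)) = A * K ^ (p - 1) := by rw [hB]; field_simp
  set A₀ := B * r ^ τ + K * r ^ (-s) with hA₀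
  refine ⟨r, A₀, hr, fun x hx hxr => ?_⟩
  have hx0 : 0 < ‖x‖ := norm_pos_iff.2 hx
  have main : ∀ ε, 0 < ε → w x ≤ (A₀ + -B * ‖x‖ ^ τ) + ε * ‖x‖ ^ (-lam) := by
    intro ε hε
    obtain ⟨r₁, hr₁, hr₁ε⟩ := hsmall ε hε
    have cs := contDiffOn_norm_rpow (n := n) τ
    have cl := contDiffOn_norm_rpow (n := n) (-lam)
    have hBr (y : 𝔼 n) (hy : ‖y‖ ≤ r) : K * r ^ (-s) ≤ A₀ + -B * ‖y‖ ^ τ := by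
      have : B * ‖y‖ ^ τ ≤ B * r ^ τ := by gcongr
      rw [hA₀]; linarith
    have hKr : 0 < K * r ^ (-s) := by positivity
    have hnear (y : 𝔼 n) (hy : y ≠ 0) (hyr : ‖y‖ < r₁) : w y ≤ ε * ‖y‖ ^ (-lam) := by
      have hy0 : 0 < ‖y‖ := norm_pos_iff.2 hy
      have h1 := hr₁ε y hy hyr
      rw [rpow_neg hy0.le, ← div_eq_mul_inv, le_div_iff₀ (by positivity)]; linarith
    refine le_of_wop_lt (a := a) (r₀ := r) (r₁ := min (r₁ / 2) r)
      (H := fun x => (A₀ + -B * ‖x‖ ^ τ) + ε * ‖x‖ ^ (-lam)) hw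
      ((contDiffOn_const.add (contDiffOn_const.mul cs)).add (contDiffOn_const.mul cl))
      (fun y hy hyr => ?_) (fun y hy hyr => ?_) (by positivity) (fun y hy hyr => ?_)
      (fun y hy hyr M hM hwM => ?_) hx hxr
    all_goals have hy0 : 0 < ‖y‖ := norm_pos_iff.2 hy
    all_goals have hεy : 0 < ε * ‖y‖ ^ (-lam) := by positivity
    · linarith [hBr y hyr]
    · have h1 := hwK y hy hyr.le
      have h2 := hBr y hyr.le
      rw [hyr] at h1
      linarith
    · have h1 := hnear y hy (by linarith [hyr.trans (min_le_left _ _)])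
      have h2 := hBr y (hyr.trans (min_le_right _ _))
      linarith
    · have nb : ({0}ᶜ : Set (𝔼 n)) ∈ 𝓝 y := isOpen_compl_singleton.mem_nhds hy
      have ds := cs.contDiffAt nb
      have dl := cl.contDiffAt nb
      rw [wop_add (contDiffAt_const.add (contDiffAt_const.mul ds)) (contDiffAt_const.mul dl),
        wop_add contDiffAt_const (contDiffAt_const.mul ds), wop_const, wop_const_mul ds,
        wop_const_mul dl, wop_norm_rpow a _ hy, wop_norm_rpow a _ hy, ← hlam]
      have hwy := hpos y hy
      have e1 : ‖y‖ ^ (lam * (p - 2) - 2) * (‖y‖ ^ (-s)) ^ (p - 1) = ‖y‖ ^ (τ - 2) := by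
        rw [← rpow_mul hy0.le, ← rpow_add hy0, neg_mul, hsτ, hτ]; ring_nf
      have h2 : wop a w y ≤ B * (τ * (τ + 2 * lam)) * ‖y‖ ^ (τ - 2) := by
        calc wop a w y ≤ A * ‖y‖ ^ (lam * (p - 2) - 2) * w y ^ (p - 1) := hP y hy
          _ ≤ A * ‖y‖ ^ (lam * (p - 2) - 2) * (K * ‖y‖ ^ (-s)) ^ (p - 1) := by
            gcongr
            exact hwK y hy hyr.le
          _ = A * K ^ (p - 1) * (‖y‖ ^ (lam * (p - 2) - 2) * (‖y‖ ^ (-s)) ^ (p - 1)) := by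
            rw [mul_rpow hK.le (by positivity)]; ring
          _ = _ := by rw [e1, hBe]
      set Q := ‖y‖ ^ (τ - 2)
      set L := ‖y‖ ^ (-lam - 2)
      have hL0 : 0 < L := by positivity
      have hQ0 : 0 < B * (τ * (τ + 2 * lam)) * Q := by positivity
      have e3 : 0 + -B * (-(τ * (τ + 2 * lam)) * Q) + ε * (-(-lam * (-lam + 2 * lam)) * L) =
          B * (τ * (τ + 2 * lam)) * Q + ε * lam ^ 2 * L := by ring
      have e4 : 0 < ε * lam ^ 2 * L := by positivity
      rw [e3]
      nlinarith
  have hlim : w x ≤ A₀ + -B * ‖x‖ ^ τ := by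
    refine le_of_forall_pos_le_add fun η hη => ?_
    have := main (η / ‖x‖ ^ (-lam)) (by positivity)
    rwa [div_mul_cancel₀ _ (by positivity)] at this
  have : 0 ≤ B * ‖x‖ ^ τ := by positivity
  linarith

theorem stmt {n : ℕ} (hn : 3 ≤ n) (a b p ν α β : ℝ)
    (ha0 : 0 ≤ a) (ha : a < ((n:ℝ)-2)/2) (hab : a ≤ b) (hba : b < a + 1)
    (hp : p = 2*(n:ℝ)/((n:ℝ)-2+2*(b-a))) (hν : 0 < ν) (hα : 1 < α) (hβ : 1 < β)
    (hαβ : α + β = p)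
    (u v : EuclideanSpace ℝ (Fin n) → ℝ)
    (hu : ContDiffOn ℝ 2 u {0}ᶜ) (hv : ContDiffOn ℝ 2 v {0}ᶜ)
    (hupos : ∀ x : EuclideanSpace ℝ (Fin n), x ≠ 0 → 0 < u x)
    (hvpos : ∀ x : EuclideanSpace ℝ (Fin n), x ≠ 0 → 0 < v x)
    (hueq : ∀ x : EuclideanSpace ℝ (Fin n), x ≠ 0 →
      -(wdiv a u x) = ‖x‖ ^ (-(b*p)) * (u x ^ (p-1) + ν*α * u x ^ (α-1) * v x ^ β))
    (hveq : ∀ x : EuclideanSpace ℝ (Fin n), x ≠ 0 →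
      -(wdiv a v x) = ‖x‖ ^ (-(b*p)) * (v x ^ (p-1) + ν*β * u x ^ α * v x ^ (β-1)))
    (hEu : finiteEnergy a u) (hEv : finiteEnergy a v) :
    ∃ C : ℝ, 0 < C ∧ ∀ x : EuclideanSpace ℝ (Fin n), x ≠ 0 → u x ≤ C ∧ v x ≤ C := by
  have hn3 : (3 : ℝ) ≤ n := by exact_mod_cast hn
  have hp2 : 2 < p := by linarith
  have hD : 0 < (n : ℝ) - 2 + 2 * (b - a) := by linarith
  have hpD : p * ((n : ℝ) - 2 + 2 * (b - a)) = 2 * n := by rw [hp]; field_simp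
  set lam := ((n : ℝ) - 2 - 2 * a) / 2 with hlam_def
  have hlam0 : 0 < lam := by rw [hlam_def]; linarith
  have hlam : 2 * lam = (n : ℝ) - 2 - 2 * a := by rw [hlam_def]; ring
  have hexp : 2 * a - b * p = lam * (p - 2) - 2 := by rw [hlam_def]; linarith
  have hpn : (p - 2) * ((n : ℝ) - 2) ≤ 4 := by
    nlinarith [mul_nonneg (by linarith : 0 ≤ p) (by linarith : 0 ≤ b - a)]
  obtain ⟨A, hA, hP⟩ := wop_add_bounds hν hα hβ hαβ hu hv hupos hvpos hueq hveq
  obtain ⟨G, hG, hG0, hwG⟩ := exists_energy_density hu hv hEu hEv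
  set w : EuclideanSpace ℝ (Fin n) → ℝ := fun y => u y + v y with hw_def
  have hw : ContDiffOn ℝ 2 w {0}ᶜ := hu.add hv
  have hpos (x) (hx : x ≠ 0) : 0 < w x := add_pos (hupos x hx) (hvpos x hx)
  rw [hexp] at hP
  have hdecay := @exists_norm_rpow_mul_le n (by omega) a p lam A ha0 hp2 hlam hpn hA w G hw hpos hP
    hG hG0 hwG
  obtain ⟨r, C₁, hr, hC₁⟩ := exists_le_near_zero hp2 hlam0 hlam hA hw hpos
    (fun x hx => (hP x hx).2) fun δ hδ => by
      obtain ⟨r, R, hr, -, h⟩ := hdecay hδ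
      exact ⟨r, hr, fun x hx hxr => h x hx (Or.inl hxr)⟩
  obtain ⟨_, R, -, -, hRw⟩ := hdecay one_pos
  set S : Set (EuclideanSpace ℝ (Fin n)) := Metric.closedBall 0 (max R 1) ∩ {y | r ≤ ‖y‖}
  have hSc : IsCompact S := (isCompact_closedBall _ _).inter_right
    (isClosed_le continuous_const continuous_norm)
  obtain ⟨C₂, hC₂⟩ := hSc.bddAbove_image (f := w) (hw.continuousOn.mono fun y hy =>
    norm_pos_iff.1 (hr.trans_le hy.2))
  have hbound (x) (hx : x ≠ 0) : w x ≤ max 1 (max C₁ C₂) := by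
    rcases le_or_gt ‖x‖ r with h | h
    · exact (hC₁ x hx h).trans ((le_max_left _ _).trans (le_max_right _ _))
    rcases le_or_gt ‖x‖ (max R 1) with h' | h'
    · exact (hC₂ ⟨x, ⟨by simpa using h', h.le⟩, rfl⟩).trans
        ((le_max_right _ _).trans (le_max_right _ _))
    · have h1 := hRw x hx (Or.inr ((le_max_left _ _).trans_lt h'))
      have h2 : 1 ≤ ‖x‖ ^ lam := one_le_rpow ((le_max_right _ _).trans h'.le) hlam0.le
      refine le_trans ?_ (le_max_left _ _)
      nlinarith [hpos x hx]
  refine ⟨max 1 (max C₁ C₂), by positivity, fun x hx => ?_⟩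
  have h1 : u x + v x ≤ max 1 (max C₁ C₂) := hbound x hx
  exact ⟨by linarith [hvpos x hx], by linarith [hupos x hx]⟩
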